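/- arXiv:2005.09462 — 2 statements merged into one kernel-verified Lean document; each statement's English description precedes it below -/
import Mathlib

section
/- Let S = (r; m_2,...,m_l) be a tree eccentric sequence, T a tree with eccentric sequence S on n vertices and diameter d = r + l - 1, and k ∈ {2,...,n-1}. Then SW_k(T) ≥ SW_k(T(r; m_2,...,m_l)), where T(r;m_2,...,m_l) is the standard caterpillar. Moreover, if k ≤ n - ⌈d/2⌉, then equality implies T ≅ T(r; m_2,...,m_l). -/
open SimpleGraph Finset

attribute [local instance] Classical.propDecidable

variable {V : Type*}

/-- The eccentricity of a vertex: the maximum distance to any other vertex. -/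
noncomputable def ecc [Fintype V] (G : SimpleGraph V) (v : V) : ℕ :=
  Finset.univ.sup fun u => G.dist v u

/-- The diameter: the maximum eccentricity. -/
noncomputable def graphDiam [Fintype V] (G : SimpleGraph V) : ℕ :=
  Finset.univ.sup fun v => ecc G v

/-- The radius: the minimum eccentricity. -/
noncomputable def graphRad [Fintype V] [Nonempty V] (G : SimpleGraph V) : ℕ :=
  Finset.univ.inf' Finset.univ_nonempty fun v => ecc G v

/-- The Wiener-type index `W(G;g)`: sum of `g (d(u,v))` over unordered pairs of
distinct vertices (here realised as half of the sum over ordered pairs). -/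
noncomputable def wiener [Fintype V] (G : SimpleGraph V) (g : ℕ → ℝ) : ℝ :=
  (∑ p ∈ Finset.univ.offDiag, g (G.dist p.1 p.2)) / 2

/-- Steiner distance of a set `A`: minimum number of edges of a subtree whose
vertex set contains `A` (in a tree, a connected subgraph on `m+1` vertices has `m` edges). -/
noncomputable def steinerDist [Fintype V] (G : SimpleGraph V) (A : Finset V) : ℕ :=
  sInf {m | ∃ S : Finset V, A ⊆ S ∧ (G.induce (S : Set V)).Connected ∧ S.card = m + 1}

/-- The `k`-Steiner Wiener index. -/
noncomputable def steinerWiener [Fintype V] (G : SimpleGraph V) (k : ℕ) : ℕ :=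
  ∑ A ∈ Finset.univ.powersetCard k, steinerDist G A

/-- A leaf (pendent vertex): a vertex of degree 1. -/
def IsLeaf (G : SimpleGraph V) (v : V) : Prop :=
  Nat.card {u : V // G.Adj v u} = 1

/-- A caterpillar: a tree in which deleting all leaves yields a path;
equivalently (for trees) every non-leaf vertex has at most two non-leaf neighbours. -/
def IsCaterpillar (G : SimpleGraph V) : Prop :=
  ∀ v : V, ¬ IsLeaf G v → Nat.card {u : V // G.Adj v u ∧ ¬ IsLeaf G u} ≤ 2

/-- Two graphs have the same eccentric sequence. -/
def sameEccSeq {W : Type*} [Fintype V] [Fintype W]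
    (G : SimpleGraph V) (H : SimpleGraph W) : Prop :=
  ∀ k : ℕ, Nat.card {v : V // ecc G v = k} = Nat.card {w : W // ecc H w = k}

/-- Vertex type of the standard caterpillar `T(r; m₂,…,m_l)`: the path
`v_0,…,v_{r+l-1}` together with `m_j - 2` pendent vertices attached at `v_{l+1-j}`
for each `2 ≤ j ≤ l` (indexed by `i = j - 2`). -/
abbrev StdVert (r l : ℕ) (m : ℕ → ℕ) : Type :=
  Fin (r + l) ⊕ ((i : Fin (l - 1)) × Fin (m (i.1 + 2) - 2))

/-- Base relation of the standard caterpillar: consecutive path vertices are adjacent,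
and each pendent vertex with index `i` (i.e. `j = i + 2`) is adjacent to `v_{l-1-i} = v_{l+1-j}`. -/
def stdRel (r l : ℕ) (m : ℕ → ℕ) : StdVert r l m → StdVert r l m → Prop
  | Sum.inl a, Sum.inl b => (a : ℕ) + 1 = (b : ℕ)
  | Sum.inr ⟨i, _⟩, Sum.inl a => (a : ℕ) = l - 1 - (i : ℕ)
  | _, _ => False

/-- The standard caterpillar `T(r; m₂,…,m_l)`. -/
def stdCat (r l : ℕ) (m : ℕ → ℕ) : SimpleGraph (StdVert r l m) :=
  SimpleGraph.fromRel (stdRel r l m)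

/-- A presentation of the graph `G` as a tree with a root, parent map and depth function. -/
structure ParentTree (G : SimpleGraph V) where
  root : V
  parent : V → V
  depth : V → ℕ
  parent_root : parent root = root
  depth_root : depth root = 0
  depth_parent : ∀ v, v ≠ root → depth (parent v) + 1 = depth v
  adj_iff : ∀ u v, G.Adj u v ↔ (u ≠ root ∧ parent u = v) ∨ (v ≠ root ∧ parent v = u)

theorem SimpleGraph.IsTree.exists_parentTree {G : SimpleGraph V} (hG : G.IsTree) (c : V) :
    ∃ R : ParentTree G, R.root = c ∧ ∀ v, R.depth v = G.dist v c := by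
  choose P hP using fun v => hG.connected.exists_walk_length_eq_dist v c
  have key : ∀ u v, G.Adj u v → G.dist u c = G.dist v c + 1 → (P u).snd = v := by
    intro u v h hd
    have h1 : (Walk.cons h (P v)).IsPath :=
      Walk.isPath_of_length_eq_dist _ (by rw [Walk.length_cons, hP, hd])
    have h2 : (P u).IsPath := Walk.isPath_of_length_eq_dist _ (hP u)
    have h3 : P u = Walk.cons h (P v) :=
      (hG.existsUnique_path _ _).unique h2 h1
    rw [h3]; simp
  have hnil : ∀ v, v ≠ c → ¬ (P v).Nil := fun v hv => Walk.not_nil_of_ne hv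
  have hadj : ∀ v, v ≠ c → G.Adj v (P v).snd := fun v hv => (P v).adj_snd (hnil v hv)
  have hdist : ∀ v, v ≠ c → G.dist (P v).snd c + 1 = G.dist v c := by
    intro v hv
    have h1 := dist_le (P v).tail
    have h2 := Walk.length_tail_add_one (hnil v hv)
    have h3 := hP v
    have h4 := hG.dist_eq_dist_add_one_of_adj c (hadj v hv)
    rw [dist_comm, dist_comm (u := c)] at h4
    omega
  refine ⟨⟨c, fun v => if v = c then c else (P v).snd, fun v => G.dist v c, by simp, by simp,
    ?_, ?_⟩, rfl, fun _ => rfl⟩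
  · intro v hv
    simpa [hv] using hdist v hv
  · intro u v
    constructor
    · intro h
      have h4 := hG.dist_eq_dist_add_one_of_adj c h
      rw [dist_comm, dist_comm (u := c)] at h4
      rcases h4 with h4 | h4
      · have hu : u ≠ c := by rintro rfl; simp at h4
        exact Or.inl ⟨hu, by simpa [hu] using key u v h h4⟩
      · have hv : v ≠ c := by rintro rfl; simp at h4
        exact Or.inr ⟨hv, by simpa [hv] using key v u h.symm h4⟩
    · rintro (⟨hu, h⟩ | ⟨hv, h⟩)
      · rw [if_neg hu] at h
        exact h ▸ hadj u hu
      · rw [if_neg hv] at h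
        exact (h ▸ hadj v hv).symm

namespace ParentTree

variable {G : SimpleGraph V} (R : ParentTree G)

/-- `u` is a descendant of `v` (possibly `u = v`). -/
def Desc (u v : V) : Prop := ∃ i, R.parent^[i] u = v

theorem desc_refl (v : V) : R.Desc v v := ⟨0, rfl⟩

theorem desc_root_iff (v : V) : R.Desc R.root v ↔ v = R.root := by
  have h (i : ℕ) : R.parent^[i] R.root = R.root := Function.iterate_fixed R.parent_root i
  constructor
  · rintro ⟨i, rfl⟩
    exact h i
  · rintro rfl
    exact R.desc_refl _

theorem desc_iff_eq_or (u v : V) : R.Desc u v ↔ u = v ∨ R.Desc (R.parent u) v := by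
  constructor
  · rintro ⟨_ | i, h⟩
    · exact Or.inl h
    · exact Or.inr ⟨i, by simpa using h⟩
  · rintro (rfl | ⟨i, h⟩)
    · exact R.desc_refl _
    · exact ⟨i + 1, by simpa using h⟩

variable {R} in
theorem Desc.parent {u v : V} (h : R.Desc u v) : R.Desc u (R.parent v) := by
  obtain ⟨i, rfl⟩ := h
  exact ⟨i + 1, by rw [Function.iterate_succ_apply']⟩

variable {R} in
theorem Desc.trans {u v w : V} (h : R.Desc u v) (h' : R.Desc v w) : R.Desc u w := by
  obtain ⟨i, rfl⟩ := h
  obtain ⟨j, rfl⟩ := h'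
  exact ⟨j + i, by rw [Function.iterate_add_apply]⟩

theorem depth_eq_zero_iff (v : V) : R.depth v = 0 ↔ v = R.root := by
  constructor
  · intro h
    by_contra hv
    have := R.depth_parent v hv
    omega
  · rintro rfl
    exact R.depth_root

/-- Induction from the root along the parent map. -/
theorem parent_induction {P : V → Prop} (root : P R.root)
    (step : ∀ v, v ≠ R.root → P (R.parent v) → P v) (v : V) : P v := by
  induction h : R.depth v generalizing v with
  | zero => rwa [(R.depth_eq_zero_iff v).1 h]
  | succ n ih =>
    have hv : v ≠ R.root := by
      rintro rfl
      simp [R.depth_root] at h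
    exact step v hv (ih _ (by have := R.depth_parent v hv; omega))

theorem desc_root (v : V) : R.Desc v R.root := by
  induction v using R.parent_induction with
  | root => exact R.desc_refl _
  | step v _ ih => exact (R.desc_iff_eq_or _ _).2 (Or.inr ih)

theorem adj_parent {v : V} (hv : v ≠ R.root) : G.Adj v (R.parent v) :=
  (R.adj_iff _ _).2 (Or.inl ⟨hv, rfl⟩)

theorem Desc.eq_or_depth_lt {R : ParentTree G} {u v : V} (h : R.Desc u v) :
    u = v ∨ R.depth v < R.depth u := by
  induction u using R.parent_induction with
  | root => exact Or.inl ((R.desc_root_iff v).1 h).symm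
  | step u hu ih =>
    have := R.depth_parent u hu
    rcases (R.desc_iff_eq_or _ _).1 h with h | h
    · exact Or.inl h
    · right
      rcases ih h with h | h
      · rw [← h]; omega
      · omega

theorem eq_and_eq_of_adj {u w v : V} (h : G.Adj u w) (hu : R.Desc u v) (hw : ¬ R.Desc w v) :
    u = v ∧ w = R.parent v := by
  rcases (R.adj_iff _ _).1 h with ⟨h0, h⟩ | ⟨h0, h⟩
  · rcases (R.desc_iff_eq_or _ _).1 hu with rfl | h'
    · exact ⟨rfl, h.symm⟩
    · rw [h] at h'; exact (hw h').elim
  · exact (hw ((R.desc_iff_eq_or _ _).2 (Or.inr (h ▸ hu)))).elim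

/-- The edge from `v` to its parent separates the set `A`. -/
def Separates (A : Finset V) (v : V) : Prop :=
  v ≠ R.root ∧ (∃ u ∈ A, R.Desc u v) ∧ ∃ u ∈ A, ¬ R.Desc u v

theorem Separates.mem {A S : Finset V} {v : V} {R : ParentTree G} (h : R.Separates A v)
    (hAS : A ⊆ S) (hS : (G.induce (S : Set V)).Connected) : v ∈ S ∧ R.parent v ∈ S := by
  obtain ⟨_, ⟨u, hu, huv⟩, w, hw, hwv⟩ := h
  obtain ⟨p⟩ := hS.preconnected ⟨u, hAS hu⟩ ⟨w, hAS hw⟩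
  obtain ⟨⟨⟨a, b⟩, hab⟩, _, ha, hb⟩ := p.exists_boundary_dart {a | R.Desc a.1 v} huv hwv
  obtain ⟨h1, h2⟩ := R.eq_and_eq_of_adj (u := a.1) (w := b.1) hab ha hb
  exact ⟨h1 ▸ a.2, h2 ▸ b.2⟩

variable [Fintype V]

theorem card_separates_lt {A S : Finset V} (hAS : A ⊆ S)
    (hS : (G.induce (S : Set V)).Connected) :
    #{v | R.Separates A v} < #S := by
  have hne : S.Nonempty := by
    obtain ⟨⟨s, hs⟩⟩ := hS.nonempty
    exact ⟨s, hs⟩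
  obtain ⟨t, ht, hmin⟩ := S.exists_min_image R.depth hne
  refine (Finset.card_le_card (t := S.erase t) ?_).trans_lt (Finset.card_erase_lt_of_mem ht)
  intro v hv
  have hv := (Finset.mem_filter.1 hv).2
  have := hv.mem hAS hS
  refine Finset.mem_erase.2 ⟨?_, this.1⟩
  rintro rfl
  have h1 := hmin _ this.2
  have h2 := R.depth_parent v hv.1
  omega

theorem exists_connected_card_le {A : Finset V} (hA : A.Nonempty) :
    ∃ S : Finset V, A ⊆ S ∧ (G.induce (S : Set V)).Connected ∧
      #S ≤ #{v | R.Separates A v} + 1 := by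
  obtain ⟨t, ht, hmax⟩ := Finset.exists_max_image
    ({v | ∀ u ∈ A, R.Desc u v} : Finset V) R.depth ⟨R.root, by simp [R.desc_root]⟩
  simp only [Finset.mem_filter, Finset.mem_univ, true_and] at ht hmax
  obtain ⟨a, ha⟩ := hA
  let S : Finset V := {v | R.Desc v t ∧ ∃ u ∈ A, R.Desc u v}
  have hS : ∀ v, v ∈ S ↔ R.Desc v t ∧ ∃ u ∈ A, R.Desc u v := by simp [S]
  have htS : t ∈ S := (hS t).2 ⟨R.desc_refl t, a, ha, ht a ha⟩
  refine ⟨S, fun u hu => (hS u).2 ⟨ht u hu, u, hu, R.desc_refl u⟩, ?_, ?_⟩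
  · have hreach : ∀ v, ∀ h : v ∈ S,
        (G.induce (S : Set V)).Reachable ⟨v, h⟩ ⟨t, htS⟩ := by
      intro v
      induction v using R.parent_induction with
      | root =>
        intro h
        have := (R.desc_root_iff t).1 ((hS _).1 h).1
        subst this
        exact Reachable.refl _
      | step v hv ih =>
        intro h
        obtain ⟨h1, u, hu, h2⟩ := (hS v).1 h
        rcases (R.desc_iff_eq_or _ _).1 h1 with rfl | h1
        · exact Reachable.refl _
        · have hp : R.parent v ∈ S := (hS _).2 ⟨h1, u, hu, h2.parent⟩
          have hadj : (G.induce (S : Set V)).Adj ⟨v, h⟩ ⟨R.parent v, hp⟩ := R.adj_parent hv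
          exact hadj.reachable.trans (ih hp)
    have : Nonempty (S : Set V) := ⟨⟨t, htS⟩⟩
    exact ⟨fun u v => (hreach u.1 u.2).trans (hreach v.1 v.2).symm⟩
  · rw [← Finset.card_erase_add_one htS]
    refine Nat.add_le_add_right (Finset.card_le_card ?_) 1
    intro v hv
    obtain ⟨hvt, hv⟩ := Finset.mem_erase.1 hv
    obtain ⟨h1, u, hu, h2⟩ := (hS v).1 hv
    have hlt := h1.eq_or_depth_lt.resolve_left hvt
    refine Finset.mem_filter.2 ⟨Finset.mem_univ _, ?_, ⟨u, hu, h2⟩, ?_⟩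
    · rintro rfl
      rw [R.depth_root] at hlt
      omega
    · by_contra! hcon
      have := hmax v hcon
      omega

theorem steinerDist_eq {A : Finset V} (hA : A.Nonempty) :
    steinerDist G A = #{v | R.Separates A v} := by
  obtain ⟨S, hAS, hS, hcard⟩ := R.exists_connected_card_le hA
  apply le_antisymm
  · refine Nat.sInf_le ⟨S, hAS, hS, ?_⟩
    have := R.card_separates_lt hAS hS
    omega
  · have hne : {m | ∃ S : Finset V, A ⊆ S ∧ (G.induce (S : Set V)).Connected ∧
        S.card = m + 1}.Nonempty := by
      refine ⟨#S - 1, S, hAS, hS, ?_⟩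
      have := R.card_separates_lt hAS hS
      omega
    obtain ⟨S', h1, h2, h3⟩ := Nat.sInf_mem hne
    have := R.card_separates_lt h1 h2
    unfold steinerDist
    omega

/-- The number of descendants of a vertex. -/
noncomputable def size (v : V) : ℕ := #{u | R.Desc u v}

theorem size_pos (v : V) : 1 ≤ R.size v :=
  Finset.card_pos.2 ⟨v, by simp [R.desc_refl]⟩

theorem card_separates_add {k : ℕ} (hk : 1 ≤ k) {v : V} (hv : v ≠ R.root) :
    #{A ∈ Finset.univ.powersetCard k | R.Separates A v} +
      ((R.size v).choose k + (Fintype.card V - R.size v).choose k) =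
      (Fintype.card V).choose k := by
  let D : Finset V := {u | R.Desc u v}
  have hD : ∀ u, u ∈ D ↔ R.Desc u v := by simp [D]
  have h1 : (R.size v).choose k = #(D.powersetCard k) := by
    rw [Finset.card_powersetCard]; rfl
  have h2 : (Fintype.card V - R.size v).choose k = #(Dᶜ.powersetCard k) := by
    rw [Finset.card_powersetCard, Finset.card_compl]; rfl
  have h3 : (Fintype.card V).choose k = #(Finset.univ.powersetCard k : Finset (Finset V)) := by
    rw [Finset.card_powersetCard]; rfl
  have hdisj : Disjoint (D.powersetCard k) (Dᶜ.powersetCard k) := by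
    rw [Finset.disjoint_left]
    intro A hA hA'
    rw [Finset.mem_powersetCard] at hA hA'
    obtain ⟨a, ha⟩ := Finset.card_pos.1 (by omega : 0 < #A)
    exact Finset.mem_compl.1 (hA'.1 ha) (hA.1 ha)
  rw [h1, h2, h3, ← Finset.card_union_of_disjoint hdisj, ← Finset.card_union_of_disjoint]
  · congr 1
    ext A
    rw [Finset.mem_union, Finset.mem_union, Finset.mem_filter, Separates]
    simp only [Finset.mem_powersetCard, Finset.subset_iff, Finset.mem_compl, hD,
      Finset.mem_univ, implies_true, true_and]
    grind
  · rw [Finset.disjoint_left]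
    intro A hA hA'
    rw [Finset.mem_filter, Separates] at hA
    simp only [Finset.mem_union, Finset.mem_powersetCard, Finset.subset_iff, Finset.mem_compl,
      hD] at hA'
    grind

theorem steinerWiener_add {k : ℕ} (hk : 1 ≤ k) :
    steinerWiener G k + ∑ v ∈ Finset.univ.erase R.root,
        ((R.size v).choose k + (Fintype.card V - R.size v).choose k) =
      (Fintype.card V - 1) * (Fintype.card V).choose k := by
  have h1 : steinerWiener G k = ∑ v ∈ Finset.univ.erase R.root,
      #{A ∈ Finset.univ.powersetCard k | R.Separates A v} := by
    have h2 : ∀ A ∈ (Finset.univ.powersetCard k : Finset (Finset V)), steinerDist G A =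
        #{v ∈ Finset.univ.erase R.root | R.Separates A v} := by
      intro A hA
      rw [R.steinerDist_eq (Finset.card_pos.1 (by have := (Finset.mem_powersetCard.1 hA).2; omega))]
      congr 1
      ext v
      simp only [Finset.mem_filter, Finset.mem_univ, true_and, Finset.mem_erase, and_true,
        iff_and_self]
      exact fun h => h.1
    rw [steinerWiener, Finset.sum_congr rfl h2]
    exact Finset.sum_card_bipartiteAbove_eq_sum_card_bipartiteBelow _
  rw [h1, ← Finset.sum_add_distrib,
    Finset.sum_congr rfl fun v hv => R.card_separates_add hk (Finset.mem_erase.1 hv).1]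
  simp [Finset.card_erase_of_mem]

end ParentTree

namespace ParentTree

variable {G : SimpleGraph V} (R : ParentTree G)

theorem connected (R : ParentTree G) : G.Connected := by
  have h : ∀ v, G.Reachable v R.root := by
    intro v
    induction v using R.parent_induction with
    | root => exact Reachable.refl _
    | step v hv ih => exact (R.adj_parent hv).reachable.trans ih
  have : Nonempty V := ⟨R.root⟩
  exact ⟨fun u v => (h u).trans (h v).symm⟩

theorem Desc.dist_add_depth_le {R : ParentTree G} {u v : V} (h : R.Desc u v) :
    G.dist u v + R.depth v ≤ R.depth u := by
  induction u using R.parent_induction with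
  | root => rw [(R.desc_root_iff v).1 h]; simp
  | step u hu ih =>
    rcases (R.desc_iff_eq_or _ _).1 h with rfl | h
    · simp
    · have h1 := ih h
      have h2 := R.depth_parent u hu
      have h3 := R.connected.dist_triangle (u := u) (v := R.parent u) (w := v)
      have h4 := dist_eq_one_iff_adj.2 (R.adj_parent hu)
      omega

theorem Desc.dist_le {R : ParentTree G} {u v w : V} (hu : R.Desc u w) (hv : R.Desc v w) :
    G.dist u v + 2 * R.depth w ≤ R.depth u + R.depth v := by
  have h1 := hu.dist_add_depth_le
  have h2 := hv.dist_add_depth_le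
  have h3 := R.connected.dist_triangle (u := u) (v := w) (w := v)
  rw [dist_comm (u := w)] at h3
  omega

theorem dist_le (u v : V) : G.dist u v ≤ R.depth u + R.depth v := by
  have := (R.desc_root u).dist_le (R.desc_root v)
  omega

theorem even_length_add {u v : V} (p : G.Walk u v) :
    Even (p.length + R.depth u + R.depth v) := by
  induction p with
  | nil => simp
  | @cons u v w h p ih =>
    rw [Walk.length_cons]
    have : R.depth u = R.depth v + 1 ∨ R.depth v = R.depth u + 1 := by
      rcases (R.adj_iff _ _).1 h with ⟨h0, rfl⟩ | ⟨h0, rfl⟩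
      · exact Or.inl (R.depth_parent _ h0).symm
      · exact Or.inr (R.depth_parent _ h0).symm
    grind

theorem even_dist_add (u v : V) : Even (G.dist u v + R.depth u + R.depth v) := by
  obtain ⟨p, hp⟩ := R.connected.exists_walk_length_eq_dist u v
  exact hp ▸ R.even_length_add p

/-- Vertices on different sides of an edge at the root are as far apart as their depths allow. -/
theorem depth_add_depth_le_dist {s u v : V} (hs : s ≠ R.root) (hs' : R.parent s = R.root)
    (hu : R.Desc u s) (hv : ¬ R.Desc v s) : R.depth u + R.depth v ≤ G.dist u v := by
  let g : V → ℤ := fun w => if R.Desc w s then R.depth w else -R.depth w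
  have hs1 : R.depth s = 1 := by
    rw [← R.depth_parent s hs, hs', R.depth_root]
  have key : ∀ a b, G.Adj a b → g a ≤ g b + 1 := by
    have hpar : ∀ a, a ≠ R.root → g a ≤ g (R.parent a) + 1 ∧ g (R.parent a) ≤ g a + 1 := by
      intro a ha
      have h1 := R.depth_parent a ha
      simp only [g]
      rcases eq_or_ne a s with rfl | has
      · rw [if_pos (R.desc_refl a), hs', if_neg (by rw [desc_root_iff]; exact hs), R.depth_root,
          hs1]
        omega
      · have h2 : R.Desc a s ↔ R.Desc (R.parent a) s := by
          rw [R.desc_iff_eq_or a s]; simp [has]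
        by_cases h3 : R.Desc a s
        · rw [if_pos h3, if_pos (h2.1 h3)]; omega
        · rw [if_neg h3, if_neg (mt h2.2 h3)]; omega
    intro a b hab
    rcases (R.adj_iff _ _).1 hab with ⟨h0, rfl⟩ | ⟨h0, rfl⟩
    · exact (hpar _ h0).1
    · exact (hpar _ h0).2
  have hwalk : ∀ a b (p : G.Walk a b), g a ≤ g b + p.length := by
    intro a b p
    induction p with
    | nil => simp
    | cons h p ih =>
      have := key _ _ h
      rw [Walk.length_cons]
      push_cast
      omega
  obtain ⟨p, hp⟩ := R.connected.exists_walk_length_eq_dist u v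
  have := hwalk u v p
  simp only [g, hu, hv, if_true, if_false] at this
  omega

theorem depth_iterate (v : V) {i : ℕ} (hi : i ≤ R.depth v) :
    R.depth (R.parent^[i] v) + i = R.depth v := by
  induction i with
  | zero => simp
  | succ i ih =>
    have h1 := ih (by omega)
    rw [Function.iterate_succ_apply']
    have := R.depth_parent (R.parent^[i] v) (by
      intro h0
      rw [h0, R.depth_root] at h1
      omega)
    omega

theorem depth_le_of_desc {R : ParentTree G} {u v : V} (h : R.Desc u v) :
    R.depth v ≤ R.depth u := by
  rcases h.eq_or_depth_lt with rfl | h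
  · exact le_rfl
  · exact h.le

end ParentTree

theorem dist_le_ecc [Fintype V] (G : SimpleGraph V) (u v : V) : G.dist u v ≤ ecc G u :=
  Finset.le_sup (f := fun w => G.dist u w) (Finset.mem_univ v)

theorem exists_dist_eq_ecc [Fintype V] (G : SimpleGraph V) (u : V) :
    ∃ v, G.dist u v = ecc G u := by
  obtain ⟨v, _, hv⟩ := Finset.exists_mem_eq_sup Finset.univ ⟨u, Finset.mem_univ u⟩
    (fun w => G.dist u w)
  exact ⟨v, hv.symm⟩

/-- A tree of radius `r` and diameter `r + l - 1` rooted at a central vertex, together with the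
child `branch` of the root and the ends `far` and `near` of a longest path: `far` lies in the
branch of `branch`, which contains the other central vertex if `l = r`. -/
structure CentralTree (G : SimpleGraph V) (r l : ℕ) extends ParentTree G where
  branch : V
  far : V
  near : V
  two_le : 2 ≤ l
  radius_le : r ≤ l
  le_radius : l ≤ r + 1
  branch_ne : branch ≠ root
  parent_branch : parent branch = root
  far_desc : toParentTree.Desc far branch
  depth_far : depth far = r
  near_not_desc : ¬ toParentTree.Desc near branch
  depth_near : depth near + 1 = l
  depth_le : ∀ v, depth v ≤ r
  depth_lt : ∀ v, ¬ toParentTree.Desc v branch → depth v < l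

namespace CentralTree

variable {G : SimpleGraph V} {r l : ℕ} (F : CentralTree G r l)

theorem depth_branch : F.depth F.branch = 1 := by
  rw [← F.depth_parent _ F.branch_ne, F.parent_branch, F.depth_root]

theorem one_le_depth {v : V} (hv : F.Desc v F.branch) : 1 ≤ F.depth v :=
  F.depth_branch ▸ ParentTree.depth_le_of_desc hv

/-- The excess of the eccentricity of a vertex over the radius. -/
noncomputable def level (v : V) : ℕ :=
  if F.Desc v F.branch then F.depth v + l - 1 - r else F.depth v

theorem level_of_desc {v : V} (hv : F.Desc v F.branch) : F.level v + r + 1 = F.depth v + l := by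
  have := F.one_le_depth hv
  have := F.le_radius
  have := F.radius_le
  rw [level, if_pos hv]
  omega

theorem level_of_not_desc {v : V} (hv : ¬ F.Desc v F.branch) : F.level v = F.depth v :=
  if_neg hv

theorem level_lt (v : V) : F.level v < l := by
  by_cases hv : F.Desc v F.branch
  · have h1 := F.level_of_desc hv
    have h2 := F.depth_le v
    omega
  · rw [F.level_of_not_desc hv]
    exact F.depth_lt v hv

theorem root_not_desc : ¬ F.Desc F.root F.branch := by
  rw [ParentTree.desc_root_iff]
  exact F.branch_ne

theorem level_root : F.level F.root = 0 := by
  rw [F.level_of_not_desc F.root_not_desc, F.depth_root]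

theorem level_far : F.level F.far + 1 = l := by
  have := F.level_of_desc F.far_desc
  have := F.depth_far
  omega

theorem level_near : F.level F.near + 1 = l := by
  rw [F.level_of_not_desc F.near_not_desc, F.depth_near]

theorem desc_parent_iff {v : V} (hv : v ≠ F.branch) :
    F.Desc (F.parent v) F.branch ↔ F.Desc v F.branch := by
  rw [ParentTree.desc_iff_eq_or _ v F.branch]
  simp [hv]

theorem level_parent {v : V} (hv : 1 ≤ F.level v) : F.level (F.parent v) + 1 = F.level v := by
  have h0 : v ≠ F.root := by
    rintro rfl
    rw [F.level_root] at hv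
    omega
  have h1 := F.depth_parent v h0
  rcases eq_or_ne v F.branch with rfl | hb
  · have h2 := F.level_of_desc (F.desc_refl F.branch)
    rw [F.depth_branch] at h2
    have := F.le_radius
    rw [F.parent_branch, F.level_root]
    omega
  · by_cases hd : F.Desc v F.branch
    · have h2 := F.level_of_desc hd
      have h3 := F.level_of_desc ((F.desc_parent_iff hb).2 hd)
      omega
    · rw [F.level_of_not_desc hd, F.level_of_not_desc (mt (F.desc_parent_iff hb).1 hd), h1]

theorem eq_of_level_eq_zero {v : V} (hv : F.level v = 0) (hv' : v ≠ F.root) :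
    v = F.branch ∧ l = r := by
  by_cases hd : F.Desc v F.branch
  · have h1 := F.level_of_desc hd
    have h2 := F.one_le_depth hd
    have h3 := F.radius_le
    refine ⟨?_, by omega⟩
    rcases hd.eq_or_depth_lt with h | h
    · exact h
    · rw [F.depth_branch] at h
      omega
  · rw [F.level_of_not_desc hd] at hv
    exact (hv' ((F.depth_eq_zero_iff v).1 hv)).elim

theorem ecc_eq [Fintype V] (v : V) : ecc G v = r + F.level v := by
  have hr := F.radius_le
  have hr' := F.le_radius
  by_cases hv : F.Desc v F.branch
  · have hl := F.level_of_desc hv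
    apply le_antisymm
    · refine Finset.sup_le fun u _ => ?_
      by_cases hu : F.Desc u F.branch
      · have := hv.dist_le hu
        have := F.depth_le u
        have := F.depth_branch
        omega
      · have := F.dist_le v u
        have := F.depth_lt u hu
        omega
    · have h1 := F.depth_add_depth_le_dist F.branch_ne F.parent_branch hv F.near_not_desc
      have h2 := dist_le_ecc G v F.near
      have := F.depth_near
      omega
  · rw [F.level_of_not_desc hv]
    apply le_antisymm
    · refine Finset.sup_le fun u _ => ?_
      have := F.dist_le v u
      have := F.depth_le u
      omega
    · have h1 := F.depth_add_depth_le_dist F.branch_ne F.parent_branch F.far_desc hv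
      have h2 := dist_le_ecc G v F.far
      rw [dist_comm] at h2
      have := F.depth_far
      omega

end CentralTree

theorem SimpleGraph.IsTree.exists_centralTree [Fintype V] {G : SimpleGraph V} (hG : G.IsTree)
    {r l : ℕ} (hl : 2 ≤ l) (hrl : l = r ∨ l = r + 1) {c x : V} (hc : ecc G c = r)
    (hx : ecc G x + 1 = r + l) (hle : ∀ v, ecc G v + 1 ≤ r + l) :
    Nonempty (CentralTree G r l) := by
  obtain ⟨R, rfl, hR⟩ := hG.exists_parentTree c
  have hdepth : ∀ v, R.depth v ≤ r := fun v => by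
    rw [hR, dist_comm, ← hc]
    exact dist_le_ecc G _ v
  obtain ⟨a, b, hab, ha, hb⟩ : ∃ a b, G.dist a b + 1 = r + l ∧ R.depth a = r ∧
      R.depth b + 1 = l := by
    obtain ⟨y, hy⟩ := exists_dist_eq_ecc G x
    have h1 := R.dist_le x y
    have h2 := R.even_dist_add x y
    have h3 := hdepth x
    have h4 := hdepth y
    rw [Nat.even_iff] at h2
    by_cases h : R.depth x = r
    · exact ⟨x, y, by omega, h, by omega⟩
    · exact ⟨y, x, by rw [dist_comm]; omega, by omega, by omega⟩
  have hit := R.depth_iterate a (i := r - 1) (by omega)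
  have hs : R.parent^[r - 1] a ≠ R.root := fun h => by
    rw [h, R.depth_root] at hit
    omega
  have hs' : R.parent (R.parent^[r - 1] a) = R.root := by
    rw [← R.depth_eq_zero_iff]
    have := R.depth_parent _ hs
    omega
  have has : R.Desc a (R.parent^[r - 1] a) := ⟨r - 1, rfl⟩
  refine ⟨⟨R, R.parent^[r - 1] a, a, b, hl, by omega, by omega, hs, hs', has, ha, ?_, hb, hdepth,
    ?_⟩⟩
  · intro h
    have := has.dist_le h
    omega
  · intro v hv
    have h1 := R.depth_add_depth_le_dist hs hs' has hv
    have h2 := dist_le_ecc G a v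
    have h3 := hle a
    omega

theorem Nat.choose_add_choose_le (q a b k : ℕ) :
    (q + a).choose (k + 1) + (q + b).choose (k + 1) ≤
      q.choose (k + 1) + (q + a + b).choose (k + 1) := by
  induction a with
  | zero => simp
  | succ a ih =>
    have h1 := Nat.choose_succ_succ (q + a) k
    have h2 := Nat.choose_succ_succ (q + a + b) k
    have h3 := Nat.choose_le_choose k (show q + a ≤ q + a + b by omega)
    simp only [Nat.succ_eq_add_one] at h1 h2
    rw [← add_assoc, add_right_comm (q + a) 1 b]
    omega

theorem Nat.choose_add_choose_lt {q a b k : ℕ} (ha : 1 ≤ a) (hb : 1 ≤ b)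
    (hk : k + 2 ≤ q + a + b) :
    (q + a).choose (k + 2) + (q + b).choose (k + 2) <
      q.choose (k + 2) + (q + a + b).choose (k + 2) := by
  obtain ⟨a, rfl⟩ := Nat.exists_eq_add_of_le' ha
  obtain ⟨b, rfl⟩ := Nat.exists_eq_add_of_le' hb
  have h0 := Nat.choose_add_choose_le q a (b + 1) (k + 1)
  have h1 := Nat.choose_succ_succ (q + a) (k + 1)
  have h2 := Nat.choose_succ_succ (q + a + b + 1) (k + 1)
  have h3 := Nat.choose_le_choose (k + 1) (show q + a ≤ q + a + b by omega)
  have h4 := Nat.choose_succ_succ (q + a + b) k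
  have h5 := Nat.choose_pos (show k ≤ q + a + b by omega)
  simp only [Nat.succ_eq_add_one] at h1 h2 h4
  have h6 : q + (a + 1) + (b + 1) = q + a + b + 1 + 1 := by ring
  rw [h6]
  simp only [← add_assoc, show k + 1 + 1 = k + 2 from rfl] at *
  omega

/-- The number of `k`-subsets of an `n`-set not separated by a split into parts of size
`a` and `n - a`. -/
def splitCount (n k a : ℕ) : ℕ := a.choose k + (n - a).choose k

theorem splitCount_sub {n k a : ℕ} (h : a ≤ n) : splitCount n k (n - a) = splitCount n k a := by
  rw [splitCount, splitCount, Nat.sub_sub_self h, add_comm]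

theorem splitCount_add_le {n k q a b : ℕ} (hk : 1 ≤ k) (h : q + a + b ≤ n) :
    splitCount n k (q + a) + splitCount n k (q + b) ≤
      splitCount n k q + splitCount n k (q + a + b) := by
  obtain ⟨k, rfl⟩ := Nat.exists_eq_add_of_le' hk
  obtain ⟨c, rfl⟩ := Nat.exists_eq_add_of_le h
  have h1 := Nat.choose_add_choose_le q a b k
  have h2 := Nat.choose_add_choose_le c a b k
  simp only [splitCount]
  rw [show q + a + b + c - (q + a) = c + b by omega,
    show q + a + b + c - (q + b) = c + a by omega,
    show q + a + b + c - q = c + a + b by omega,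
    show q + a + b + c - (q + a + b) = c by omega]
  omega

theorem splitCount_add_lt {n k q a b : ℕ} (hk : 2 ≤ k) (h : q + a + b ≤ n) (ha : 1 ≤ a)
    (hb : 1 ≤ b) (hq : q + k ≤ n) :
    splitCount n k (q + a) + splitCount n k (q + b) <
      splitCount n k q + splitCount n k (q + a + b) := by
  obtain ⟨k, rfl⟩ := Nat.exists_eq_add_of_le' hk
  obtain ⟨c, rfl⟩ := Nat.exists_eq_add_of_le h
  have h1 := Nat.choose_add_choose_le q a b (k + 1)
  have h2 := Nat.choose_add_choose_lt (q := c) (k := k) ha hb (by omega)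
  simp only [splitCount, show k + 1 + 1 = k + 2 from rfl] at *
  rw [show q + a + b + c - (q + a) = c + b by omega,
    show q + a + b + c - (q + b) = c + a by omega,
    show q + a + b + c - q = c + a + b by omega,
    show q + a + b + c - (q + a + b) = c by omega]
  omega

theorem splitCount_le_of_le {n k q s : ℕ} (hk : 1 ≤ k) (h : q ≤ s) (h' : q + s ≤ n) :
    splitCount n k s ≤ splitCount n k q := by
  have h1 := splitCount_add_le (n := n) (q := q) (a := s - q) (b := n - s - q) hk (by omega)
  rw [show q + (s - q) = s by omega, show q + (n - s - q) = n - s by omega,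
    show s + (n - s - q) = n - q by omega, splitCount_sub (by omega),
    splitCount_sub (by omega)] at h1
  omega

theorem splitCount_lt_of_lt {n k q s : ℕ} (hk : 2 ≤ k) (h : q < s) (h' : q + s < n)
    (hq : q + k ≤ n) : splitCount n k s < splitCount n k q := by
  have h1 := splitCount_add_lt (n := n) (q := q) (a := s - q) (b := n - s - q) hk (by omega)
    (by omega) (by omega) hq
  rw [show q + (s - q) = s by omega, show q + (n - s - q) = n - s by omega,
    show s + (n - s - q) = n - q by omega, splitCount_sub (by omega),
    splitCount_sub (by omega)] at h1
  omega

section Transfer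

variable {n k : ℕ} {M : Finset V} {e : V → ℕ}

theorem sum_splitCount_add_le {w : ℕ} (hk : 1 ≤ k)
    (h : w + 1 + ∑ v ∈ M, e v ≤ n) :
    ∑ v ∈ M, splitCount n k (e v + 1) + splitCount n k (w + 1) ≤
      #M * splitCount n k 1 + splitCount n k (w + 1 + ∑ v ∈ M, e v) := by
  induction M using Finset.induction_on with
  | empty => simp
  | insert a M ha ih =>
    rw [Finset.sum_insert ha] at h
    rw [Finset.sum_insert ha, Finset.sum_insert ha, Finset.card_insert_of_notMem ha]
    have h1 := ih (by omega)
    have h2 := splitCount_add_le (n := n) (q := 1) (a := e a) (b := w + ∑ v ∈ M, e v) hk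
      (by omega)
    rw [show 1 + e a = e a + 1 by omega,
      show 1 + (w + ∑ v ∈ M, e v) = w + 1 + ∑ v ∈ M, e v by omega,
      show e a + 1 + (w + ∑ v ∈ M, e v) = w + 1 + (e a + ∑ v ∈ M, e v) by omega] at h2
    rw [add_mul, one_mul]
    omega

theorem sum_splitCount_add_lt {w : ℕ} (hk : 2 ≤ k) (hkn : k < n) (hw : 1 ≤ w)
    (h : w + 1 + ∑ v ∈ M, e v ≤ n) {a : V} (ha : a ∈ M) (hea : 1 ≤ e a) :
    ∑ v ∈ M, splitCount n k (e v + 1) + splitCount n k (w + 1) <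
      #M * splitCount n k 1 + splitCount n k (w + 1 + ∑ v ∈ M, e v) := by
  rw [← Finset.insert_erase ha] at h ⊢
  have ha' := Finset.notMem_erase a M
  rw [Finset.sum_insert ha'] at h
  rw [Finset.sum_insert ha', Finset.sum_insert ha', Finset.card_insert_of_notMem ha']
  have h1 := sum_splitCount_add_le (k := k) (M := M.erase a) (e := e) (w := w) (n := n)
    (by omega) (by omega)
  have h2 := splitCount_add_lt (n := n) (q := 1) (a := e a) (b := w + ∑ v ∈ M.erase a, e v) hk
    (by omega) hea (by omega) (by omega)
  rw [show 1 + e a = e a + 1 by omega,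
    show 1 + (w + ∑ v ∈ M.erase a, e v) = w + 1 + ∑ v ∈ M.erase a, e v by omega,
    show e a + 1 + (w + ∑ v ∈ M.erase a, e v) = w + 1 + (e a + ∑ v ∈ M.erase a, e v)
      by omega] at h2
  rw [add_mul, one_mul]
  omega

variable {L : Finset V} {a b : V} {s : V → ℕ}

theorem sum_eq_add_add_sum_erase (ha : a ∈ L) (hb : b ∈ L) (hab : a ≠ b) (f : V → ℕ) :
    ∑ v ∈ L, f v = f a + f b + ∑ v ∈ (L.erase a).erase b, f v := by
  rw [← Finset.add_sum_erase L f ha,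
    ← Finset.add_sum_erase (L.erase a) f (Finset.mem_erase.2 ⟨hab.symm, hb⟩), add_assoc]

theorem card_erase_erase (ha : a ∈ L) (hb : b ∈ L) (hab : a ≠ b) :
    #((L.erase a).erase b) + 2 = #L := by
  rw [Finset.card_erase_of_mem (Finset.mem_erase.2 ⟨hab.symm, hb⟩), Finset.card_erase_of_mem ha]
  have := Finset.one_lt_card.2 ⟨a, ha, b, hb, hab⟩
  omega

theorem sum_splitCount_le {q : ℕ} (hk : 1 ≤ k) (ha : a ∈ L) (hb : b ∈ L) (hab : a ≠ b)
    (hs : ∀ v, 1 ≤ s v) (hq : 1 ≤ q) (hsa : q ≤ s a) (hsb : q ≤ s b) (hn : ∑ v ∈ L, s v ≤ n) :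
    ∑ v ∈ L, splitCount n k (s v) ≤ (#L - 2) * splitCount n k 1 + splitCount n k q +
        splitCount n k (∑ v ∈ L, s v - (#L - 2) - q) ∧
      (∑ v ∈ L, splitCount n k (s v) = (#L - 2) * splitCount n k 1 + splitCount n k q +
        splitCount n k (∑ v ∈ L, s v - (#L - 2) - q) → 2 ≤ k → k < n → q + k ≤ n →
        (s a = q ∨ s b = q) ∧ (1 < q → ∀ v ∈ L, v ≠ a → v ≠ b → s v = 1)) := by
  have hcard := card_erase_erase ha hb hab
  have hmem : ∀ v, v ∈ (L.erase a).erase b ↔ v ≠ b ∧ v ≠ a ∧ v ∈ L := by simp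
  rw [sum_eq_add_add_sum_erase ha hb hab] at hn
  rw [sum_eq_add_add_sum_erase ha hb hab, sum_eq_add_add_sum_erase ha hb hab]
  generalize (L.erase a).erase b = M at *
  have hs' : ∀ v, s v = (s v - 1) + 1 := fun v => by have := hs v; omega
  have hsum : ∑ v ∈ M, s v = ∑ v ∈ M, (s v - 1) + #M := by
    rw [Finset.sum_congr rfl fun v _ => hs' v, Finset.sum_add_distrib]
    simp
  rw [hsum] at hn
  have hsa1 := hs a
  have h1 := sum_splitCount_add_le (n := n) (M := M) (e := fun v => s v - 1) (w := s a - 1) hk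
    (by omega)
  have h3 : ∀ v, v ∈ M → 1 ≤ s v - 1 → 2 ≤ k → k < n → 1 ≤ s a - 1 → _ :=
    fun v hv hev hk2 hkn hw => sum_splitCount_add_lt (n := n) (M := M) (e := fun v => s v - 1)
      (w := s a - 1) hk2 hkn hw (by omega) hv hev
  have h2 := splitCount_add_le (n := n) (q := q) (a := s b - q)
    (b := s a + ∑ v ∈ M, (s v - 1) - q) hk (by omega)
  have h4 : 2 ≤ k → 1 ≤ s b - q → 1 ≤ s a + ∑ v ∈ M, (s v - 1) - q → q + k ≤ n → _ :=
    fun hk2 e1 e2 => splitCount_add_lt (n := n) (q := q) (a := s b - q)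
      (b := s a + ∑ v ∈ M, (s v - 1) - q) hk2 (by omega) e1 e2
  simp only [← hs'] at h1 h3
  rw [show q + (s b - q) = s b by omega, show q + (s a + ∑ v ∈ M, (s v - 1) - q) =
    s a + ∑ v ∈ M, (s v - 1) by omega] at h2 h4
  have e3 : s a + s b + ∑ v ∈ M, s v - (#L - 2) - q =
      s b + (s a + ∑ v ∈ M, (s v - 1) - q) := by omega
  have e4 : #L - 2 = #M := by omega
  rw [e3, e4]
  refine ⟨by omega, fun heq hk2 hkn hqk => ⟨?_, fun hq1 v hv hva hvb => ?_⟩⟩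
  · by_contra! hcon
    have := h4 hk2 (by omega) (by omega) hqk
    omega
  · by_contra hcon
    have hsv := hs v
    have := h3 v ((hmem v).2 ⟨hvb, hva, hv⟩) (by omega) hk2 hkn (by omega)
    omega

theorem sum_splitCount_eq {q : ℕ} (ha : a ∈ L) (hb : b ∈ L) (hab : a ≠ b) (hsb : s b = q)
    (hs : ∀ v ∈ L, v ≠ a → v ≠ b → s v = 1) :
    ∑ v ∈ L, splitCount n k (s v) = (#L - 2) * splitCount n k 1 + splitCount n k q +
      splitCount n k (∑ v ∈ L, s v - (#L - 2) - q) := by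
  have hcard := card_erase_erase ha hb hab
  have hmem : ∀ v, v ∈ (L.erase a).erase b → s v = 1 := by
    intro v hv
    simp only [Finset.mem_erase] at hv
    exact hs v hv.2.2 hv.2.1 hv.1
  rw [sum_eq_add_add_sum_erase ha hb hab, sum_eq_add_add_sum_erase ha hb hab,
    Finset.sum_congr rfl hmem, Finset.sum_congr rfl fun v hv => congrArg _ (hmem v hv)]
  simp only [Finset.sum_const, smul_eq_mul, mul_one]
  rw [show #L - 2 = #((L.erase a).erase b) by omega, hsb, show s a + q +
    #((L.erase a).erase b) - #((L.erase a).erase b) - q = s a by omega]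
  ring

end Transfer

namespace ParentTree

variable {G : SimpleGraph V} (R : ParentTree G)

theorem iterate_injOn (v : V) : Set.InjOn (fun i => R.parent^[i] v) {i | i ≤ R.depth v} := by
  intro i hi j hj hij
  have h1 := R.depth_iterate v hi
  have h2 := R.depth_iterate v hj
  simp only at hij
  rw [hij] at h1
  omega

theorem card_image_iterate {v : V} {i : ℕ} (hi : i ≤ R.depth v + 1) :
    #((Finset.range i).image fun j => R.parent^[j] v) = i := by
  rw [Finset.card_image_of_injOn, Finset.card_range]
  refine (R.iterate_injOn v).mono fun j hj => ?_
  simp only [Finset.coe_range, Set.mem_Iio] at hj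
  simp only [Set.mem_ofPred_eq]
  omega

theorem lt_size_iterate [Fintype V] {v : V} {i : ℕ} (hi : i ≤ R.depth v) :
    i < R.size (R.parent^[i] v) := by
  rw [Nat.lt_iff_add_one_le, ← R.card_image_iterate (v := v) (i := i + 1) (by omega)]
  refine Finset.card_le_card fun w hw => ?_
  obtain ⟨j, hj, rfl⟩ := Finset.mem_image.1 hw
  have hj := Finset.mem_range.1 hj
  refine Finset.mem_filter.2 ⟨Finset.mem_univ _, i - j, ?_⟩
  rw [← Function.iterate_add_apply]
  congr 2
  omega

theorem Desc.iterate {R : ParentTree G} {u v : V} (h : R.Desc u v) {i : ℕ}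
    (hi : i + R.depth v ≤ R.depth u) : R.Desc (R.parent^[i] u) v := by
  obtain ⟨j, rfl⟩ := h
  by_cases hj : i ≤ j
  · refine ⟨j - i, ?_⟩
    rw [← Function.iterate_add_apply]
    congr 2
    omega
  · have h1 := R.depth_iterate u (i := i) (by omega)
    have h2 := R.depth_iterate u (i := j) (by omega)
    omega

end ParentTree

namespace CentralTree

variable {G : SimpleGraph V} {r l : ℕ} (F : CentralTree G r l)

theorem level_iterate (v : V) {i : ℕ} (hi : i ≤ F.level v) :
    F.level (F.parent^[i] v) + i = F.level v := by
  induction i with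
  | zero => simp
  | succ i ih =>
    have h1 := ih (by omega)
    rw [Function.iterate_succ_apply']
    have := F.level_parent (v := F.parent^[i] v) (by omega)
    omega

theorem level_parent_of_ne_zero {v : V} (hv : F.level (F.parent v) ≠ 0) :
    F.level (F.parent v) + 1 = F.level v := by
  apply F.level_parent
  by_contra! h
  apply hv
  rcases eq_or_ne v F.root with rfl | h0
  · rw [F.parent_root, F.level_root]
  · rw [(F.eq_of_level_eq_zero (by omega) h0).1, F.parent_branch, F.level_root]

theorem level_iterate_of_ne_zero {v : V} {i : ℕ} (hv : F.level (F.parent^[i] v) ≠ 0) :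
    F.level (F.parent^[i] v) + i = F.level v := by
  induction i with
  | zero => simp
  | succ i ih =>
    rw [Function.iterate_succ_apply'] at hv ⊢
    have h1 := F.level_parent_of_ne_zero hv
    have := ih (by omega)
    omega

theorem parent_iterate_level_sub {u v : V} (h : F.Desc u v) (hv : F.level v ≠ 0) :
    F.level v ≤ F.level u ∧ F.parent^[F.level u - F.level v] u = v := by
  obtain ⟨i, rfl⟩ := h
  have := F.level_iterate_of_ne_zero hv
  refine ⟨by omega, ?_⟩
  congr 2
  omega

/-- The ancestor of `near` at level `t`. -/
def nearAt (t : ℕ) : V := F.parent^[l - 1 - t] F.near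

/-- The ancestor of `far` at level `t`. -/
def farAt (t : ℕ) : V := F.parent^[l - 1 - t] F.far

theorem level_nearAt {t : ℕ} (ht : t < l) : F.level (F.nearAt t) = t := by
  have := F.level_near
  have := F.level_iterate F.near (i := l - 1 - t) (by omega)
  rw [nearAt]
  omega

theorem level_farAt {t : ℕ} (ht : t < l) : F.level (F.farAt t) = t := by
  have := F.level_far
  have := F.level_iterate F.far (i := l - 1 - t) (by omega)
  rw [farAt]
  omega

theorem not_desc_of_near_desc {v : V} (h : F.Desc F.near v) : ¬ F.Desc v F.branch :=
  fun h' => F.near_not_desc (h.trans h')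

theorem near_desc_nearAt (t : ℕ) : F.Desc F.near (F.nearAt t) := ⟨_, rfl⟩

theorem nearAt_not_desc (t : ℕ) : ¬ F.Desc (F.nearAt t) F.branch :=
  F.not_desc_of_near_desc (F.near_desc_nearAt t)

theorem farAt_desc {t : ℕ} (ht : 1 ≤ t) : F.Desc (F.farAt t) F.branch := by
  refine F.far_desc.iterate ?_
  have h1 := F.depth_branch
  have h2 := F.depth_far
  have h3 := F.le_radius
  have h4 := F.two_le
  omega

theorem nearAt_ne_farAt {t : ℕ} (ht : 1 ≤ t) : F.nearAt t ≠ F.farAt t := fun h =>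
  F.nearAt_not_desc t (h ▸ F.farAt_desc ht)

theorem eq_nearAt {v : V} (h : F.Desc F.near v) (hv : F.level v ≠ 0) :
    v = F.nearAt (F.level v) := by
  have h1 := (F.parent_iterate_level_sub h hv).2
  have h2 := F.level_near
  rw [nearAt, show l - 1 - F.level v = F.level F.near - F.level v by omega]
  exact h1.symm

theorem eq_farAt {v : V} (h : F.Desc F.far v) (hv : F.level v ≠ 0) :
    v = F.farAt (F.level v) := by
  have h1 := (F.parent_iterate_level_sub h hv).2
  have h2 := F.level_far
  rw [farAt, show l - 1 - F.level v = F.level F.far - F.level v by omega]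
  exact h1.symm

theorem farAt_one (h : l = r + 1) : F.farAt 1 = F.branch := by
  have h1 := F.level_of_desc (F.desc_refl F.branch)
  have h2 := F.depth_branch
  have h3 := F.eq_farAt F.far_desc (by omega)
  rw [show F.level F.branch = 1 by omega] at h3
  exact h3.symm

variable [Fintype V]

theorem le_size_nearAt {t : ℕ} (ht : t < l) : l - t ≤ F.size (F.nearAt t) := by
  have h1 := F.depth_near
  have := F.lt_size_iterate (v := F.near) (i := l - 1 - t) (by omega)
  rw [nearAt]
  omega

theorem le_size_farAt {t : ℕ} (ht : 1 ≤ t) (ht' : t < l) : l - t ≤ F.size (F.farAt t) := by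
  have h1 := F.depth_far
  have h2 := F.le_radius
  have := F.lt_size_iterate (v := F.far) (i := l - 1 - t) (by omega)
  rw [farAt]
  omega

theorem le_size_branch : r ≤ F.size F.branch := by
  have h1 := F.depth_far
  refine (F.card_image_iterate (v := F.far) (i := r) (by omega)).ge.trans
    (Finset.card_le_card fun w hw => ?_)
  obtain ⟨j, hj, rfl⟩ := Finset.mem_image.1 hw
  have hj := Finset.mem_range.1 hj
  refine Finset.mem_filter.2 ⟨Finset.mem_univ _, F.far_desc.iterate ?_⟩
  have := F.depth_branch
  omega

theorem size_branch_add_le : F.size F.branch + l ≤ Fintype.card V := by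
  have h1 := F.depth_near
  have h3 := Finset.card_add_card_compl ({u | F.Desc u F.branch} : Finset V)
  have h2 : l ≤ #(({u | F.Desc u F.branch} : Finset V)ᶜ) := by
    refine (F.card_image_iterate (v := F.near) (i := l) (by omega)).ge.trans
      (Finset.card_le_card fun w hw => ?_)
    obtain ⟨j, hj, rfl⟩ := Finset.mem_image.1 hw
    simp only [Finset.mem_compl, Finset.mem_filter, Finset.mem_univ, true_and]
    exact F.not_desc_of_near_desc ⟨j, rfl⟩
  rw [ParentTree.size]
  omega

theorem sum_size_level {t : ℕ} (ht : 1 ≤ t) :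
    ∑ v with F.level v = t, F.size v = #{v | t ≤ F.level v} := by
  rw [Finset.card_eq_sum_card_fiberwise (f := fun u => F.parent^[F.level u - t] u)
    (t := {v | F.level v = t})]
  · refine Finset.sum_congr rfl fun v hv => ?_
    rw [Finset.mem_filter] at hv
    obtain ⟨_, rfl⟩ := hv
    rw [ParentTree.size, Finset.filter_filter]
    congr 1
    ext u
    simp only [Finset.mem_filter, Finset.mem_univ, true_and]
    constructor
    · intro h
      exact F.parent_iterate_level_sub h (by omega)
    · rintro ⟨_, h⟩
      exact ⟨_, h⟩
  · intro u hu
    simp only [Finset.coe_filter, Finset.mem_univ, true_and, Set.mem_ofPred_eq] at hu ⊢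
    have := F.level_iterate u (i := F.level u - t) (by omega)
    omega

theorem size_eq_one_of_level {v : V} (hv : F.level v + 1 = l) : F.size v = 1 := by
  have := F.two_le
  rw [ParentTree.size, Finset.card_eq_one]
  refine ⟨v, ?_⟩
  ext u
  simp only [Finset.mem_filter, Finset.mem_univ, true_and, Finset.mem_singleton]
  constructor
  · intro h
    have h1 := F.parent_iterate_level_sub h (by omega)
    have h2 := F.level_lt u
    rw [show F.level u - F.level v = 0 by omega] at h1
    exact h1.2
  · rintro rfl
    exact F.desc_refl _

/-- The largest possible contribution of the edges between the levels `t - 1` and `t`, in terms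
of the eccentric sequence. -/
noncomputable def _root_.levelBound (G : SimpleGraph V) (r l k t : ℕ) : ℕ :=
  (#{v | ecc G v = r + t} - 2) * splitCount (Fintype.card V) k 1 +
    splitCount (Fintype.card V) k (l - t) + splitCount (Fintype.card V) k
      (#{v | r + t ≤ ecc G v} - (#{v | ecc G v = r + t} - 2) - (l - t))

theorem filter_level_eq (t : ℕ) :
    ({v | ecc G v = r + t} : Finset V) = ({v | F.level v = t} : Finset V) := by
  ext v
  simp [F.ecc_eq]

theorem filter_level_le (t : ℕ) :
    ({v | r + t ≤ ecc G v} : Finset V) = ({v | t ≤ F.level v} : Finset V) := by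
  ext v
  simp [F.ecc_eq]

theorem sum_level_le {k t : ℕ} (hk : 1 ≤ k) (ht : 1 ≤ t) (ht' : t < l) :
    ∑ v with F.level v = t, splitCount (Fintype.card V) k (F.size v) ≤ levelBound G r l k t ∧
      (∑ v with F.level v = t, splitCount (Fintype.card V) k (F.size v) = levelBound G r l k t →
        2 ≤ k → k < Fintype.card V → l - t + k ≤ Fintype.card V →
        (F.size (F.nearAt t) = l - t ∨ F.size (F.farAt t) = l - t) ∧
        ∀ v, F.level v = t → v ≠ F.nearAt t → v ≠ F.farAt t → F.size v = 1) := by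
  have h := sum_splitCount_le (n := Fintype.card V) (L := {v | F.level v = t}) (s := F.size)
    (a := F.nearAt t) (b := F.farAt t) (q := l - t) hk (by simp [F.level_nearAt ht'])
    (by simp [F.level_farAt ht']) (F.nearAt_ne_farAt ht) F.size_pos (by omega)
    (F.le_size_nearAt ht') (F.le_size_farAt ht ht')
    (by rw [F.sum_size_level ht]; exact Finset.card_le_univ _)
  rw [F.sum_size_level ht, ← F.filter_level_eq, ← F.filter_level_le] at h
  rw [← F.filter_level_eq]
  refine ⟨h.1, fun heq hk2 hkn hq => ?_⟩
  obtain ⟨h1, h2⟩ := h.2 heq hk2 hkn hq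
  refine ⟨h1, fun v hv hva hvb => ?_⟩
  rcases (show 1 ≤ l - t by omega).eq_or_lt with h3 | h3
  · exact F.size_eq_one_of_level (by omega)
  · exact h2 h3 v (by simp [F.ecc_eq, hv]) hva hvb

/-- The branch is a path, and all vertices outside the longest path are leaves. -/
def Tight : Prop :=
  F.size F.branch = r ∧ ∀ v, ¬ F.Desc v F.branch → ¬ F.Desc F.near v → F.size v = 1

variable {F} in
theorem Tight.far_desc (hF : F.Tight) {v : V} (hv : F.Desc v F.branch) : F.Desc F.far v := by
  have h1 := F.depth_far
  have h2 := F.depth_branch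
  have hsub : (Finset.range r).image (fun j => F.parent^[j] F.far) ⊆
      ({u | F.Desc u F.branch} : Finset V) := by
    intro w hw
    obtain ⟨j, hj, rfl⟩ := Finset.mem_image.1 hw
    have hj := Finset.mem_range.1 hj
    refine Finset.mem_filter.2 ⟨Finset.mem_univ _, F.far_desc.iterate ?_⟩
    omega
  have heq := Finset.eq_of_subset_of_card_le hsub (by
    rw [F.card_image_iterate (by omega)]
    exact hF.1.le)
  have hv' : v ∈ ({u | F.Desc u F.branch} : Finset V) := by simpa using hv
  rw [← heq] at hv'
  obtain ⟨j, _, rfl⟩ := Finset.mem_image.1 hv'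
  exact ⟨j, rfl⟩

variable {F} in
theorem Tight.size_farAt (hF : F.Tight) {t : ℕ} (ht : 1 ≤ t) (ht' : t < l) :
    F.size (F.farAt t) = l - t := by
  apply le_antisymm _ (F.le_size_farAt ht ht')
  have hsub : ({u | F.Desc u (F.farAt t)} : Finset V) ⊆
      (Finset.Ico t l).image F.farAt := by
    intro u hu
    rw [Finset.mem_filter] at hu
    have h2 := F.parent_iterate_level_sub hu.2 (by rw [F.level_farAt ht']; omega)
    rw [F.level_farAt ht'] at h2
    refine Finset.mem_image.2 ⟨F.level u, Finset.mem_Ico.2 ⟨h2.1, F.level_lt u⟩, ?_⟩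
    exact (F.eq_farAt (hF.far_desc (hu.2.trans (F.farAt_desc ht))) (by omega)).symm
  have := (Finset.card_le_card hsub).trans Finset.card_image_le
  rw [Nat.card_Ico] at this
  exact this

variable {F} in
theorem Tight.sum_level_eq (hF : F.Tight) {k t : ℕ} (ht : 1 ≤ t) (ht' : t < l) :
    ∑ v with F.level v = t, splitCount (Fintype.card V) k (F.size v) = levelBound G r l k t := by
  have h := sum_splitCount_eq (n := Fintype.card V) (k := k) (L := {v | F.level v = t})
    (s := F.size) (a := F.nearAt t) (b := F.farAt t) (q := l - t) (by simp [F.level_nearAt ht'])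
    (by simp [F.level_farAt ht']) (F.nearAt_ne_farAt ht) (hF.size_farAt ht ht') (by
      intro v hv hva hvb
      rw [Finset.mem_filter] at hv
      obtain ⟨_, rfl⟩ := hv
      refine hF.2 v (fun h => hvb ?_) (fun h => hva ?_)
      · exact F.eq_farAt (hF.far_desc h) (by omega)
      · exact F.eq_nearAt h (by omega))
  rw [F.sum_size_level ht, ← F.filter_level_eq, ← F.filter_level_le] at h
  rw [← F.filter_level_eq]
  exact h

theorem sum_erase_root (f : V → ℕ) :
    ∑ v ∈ Finset.univ.erase F.root, f v =
      (if l = r then f F.branch else 0) + ∑ t ∈ Finset.Ico 1 l, ∑ v with F.level v = t, f v := by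
  have h1 : ∑ v ∈ Finset.univ.erase F.root, f v =
      ∑ t ∈ Finset.range l, ∑ v ∈ Finset.univ.erase F.root with F.level v = t, f v :=
    (Finset.sum_fiberwise_of_maps_to (fun v _ => Finset.mem_range.2 (F.level_lt v)) f).symm
  have hl := F.two_le
  rw [h1, Finset.range_eq_Ico, Finset.sum_eq_sum_Ico_succ_bot (by omega)]
  congr 1
  · split_ifs with h
    · rw [Finset.sum_eq_single_of_mem F.branch]
      · have := F.level_of_desc (F.desc_refl F.branch)
        have := F.depth_branch
        simp only [Finset.mem_filter, Finset.mem_erase, Finset.mem_univ, and_true]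
        exact ⟨F.branch_ne, by omega⟩
      · intro v hv hv'
        simp only [Finset.mem_filter, Finset.mem_erase, Finset.mem_univ, and_true] at hv
        exact (hv' (F.eq_of_level_eq_zero hv.2 hv.1).1).elim
    · refine Finset.sum_eq_zero fun v hv => ?_
      simp only [Finset.mem_filter, Finset.mem_erase, Finset.mem_univ, and_true] at hv
      exact (h (F.eq_of_level_eq_zero hv.2 hv.1).2).elim
  · refine Finset.sum_congr rfl fun t ht => Finset.sum_congr ?_ fun _ _ => rfl
    ext v
    simp only [Finset.mem_filter, Finset.mem_erase, Finset.mem_univ, and_true, true_and,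
      and_iff_right_iff_imp]
    rintro hv rfl
    rw [F.level_root] at hv
    have := (Finset.mem_Ico.1 ht).1
    omega

/-- The largest possible value of the sum of the split counts over all edges. -/
noncomputable def _root_.totalBound (G : SimpleGraph V) (r l k : ℕ) : ℕ :=
  (if l = r then splitCount (Fintype.card V) k l else 0) +
    ∑ t ∈ Finset.Ico 1 l, levelBound G r l k t

theorem sum_le_totalBound {k : ℕ} (hk : 1 ≤ k) :
    ∑ v ∈ Finset.univ.erase F.root, splitCount (Fintype.card V) k (F.size v) ≤
      totalBound G r l k := by
  rw [F.sum_erase_root, totalBound]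
  refine Nat.add_le_add ?_ (Finset.sum_le_sum fun t ht => ?_)
  · split_ifs with h
    · have := F.le_size_branch
      have := F.size_branch_add_le
      exact splitCount_le_of_le hk (by omega) (by omega)
    · exact le_rfl
  · rw [Finset.mem_Ico] at ht
    exact (F.sum_level_le hk ht.1 ht.2).1

variable {F} in
theorem Tight.sum_eq_totalBound (hF : F.Tight) (k : ℕ) :
    ∑ v ∈ Finset.univ.erase F.root, splitCount (Fintype.card V) k (F.size v) =
      totalBound G r l k := by
  rw [F.sum_erase_root, totalBound]
  congr 1
  · split_ifs with h
    · rw [hF.1, h]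
    · rfl
  · refine Finset.sum_congr rfl fun t ht => ?_
    rw [Finset.mem_Ico] at ht
    exact hF.sum_level_eq ht.1 ht.2

/-- The branch of `far` is not larger than its counterpart on the side of `near`. -/
def Oriented : Prop :=
  (l = r → 2 * F.size F.branch ≤ Fintype.card V) ∧
    (l = r + 1 → F.size F.branch ≤ F.size (F.nearAt 1))

theorem tight_of_sum_eq {k : ℕ} (hF : F.Oriented) (hk : 2 ≤ k) (hkn : k < Fintype.card V)
    (hk' : (r + l) / 2 + k ≤ Fintype.card V)
    (h : ∑ v ∈ Finset.univ.erase F.root, splitCount (Fintype.card V) k (F.size v) =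
      totalBound G r l k) : F.Tight := by
  have hl := F.two_le
  have hrl := F.radius_le
  have hrl' := F.le_radius
  have hb := F.le_size_branch
  have hb' := F.size_branch_add_le
  have hlev : ∀ t ∈ Finset.Ico 1 l, ∑ v with F.level v = t,
      splitCount (Fintype.card V) k (F.size v) ≤ levelBound G r l k t := fun t ht =>
    (F.sum_level_le (by omega) (Finset.mem_Ico.1 ht).1 (Finset.mem_Ico.1 ht).2).1
  have hsum := Finset.sum_le_sum hlev
  have hbr : l = r → splitCount (Fintype.card V) k (F.size F.branch) ≤
      splitCount (Fintype.card V) k l := fun h =>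
    splitCount_le_of_le (by omega) (by omega) (by omega)
  rw [F.sum_erase_root, totalBound] at h
  have heq : ∀ t ∈ Finset.Ico 1 l, ∑ v with F.level v = t,
      splitCount (Fintype.card V) k (F.size v) = levelBound G r l k t := by
    rw [← Finset.sum_eq_sum_iff_of_le hlev]
    split_ifs at h with h0
    · have := hbr h0
      omega
    · omega
  have hconc : ∀ t, 1 ≤ t → t < l → _ := fun t ht ht' =>
    (F.sum_level_le (k := k) (by omega) ht ht').2 (heq t (Finset.mem_Ico.2 ⟨ht, ht'⟩)) hk hkn
      (by omega)
  constructor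
  · rcases hrl.eq_or_lt with h0 | h0
    · rw [if_pos h0.symm, if_pos h0.symm] at h
      have := hF.1 h0.symm
      by_contra hne
      have := splitCount_lt_of_lt (n := Fintype.card V) (k := k) (q := l) (s := F.size F.branch)
        hk (by omega) (by omega) (by omega)
      omega
    · have h1 : l = r + 1 := by omega
      have h2 := (hconc 1 le_rfl (by omega)).1
      have h3 := hF.2 h1
      rw [F.farAt_one h1] at h2
      omega
  · intro v hv hnv
    have h0 : F.level v ≠ 0 := by
      intro h0
      rcases eq_or_ne v F.root with rfl | hv0
      · exact hnv (F.desc_root _)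
      · exact hv ((F.eq_of_level_eq_zero h0 hv0).1 ▸ F.desc_refl _)
    refine (hconc (F.level v) (by omega) (F.level_lt v)).2 v rfl ?_ ?_
    · intro h1
      exact hnv (h1 ▸ F.near_desc_nearAt _)
    · intro h1
      exact hv (h1 ▸ F.farAt_desc (by omega))

end CentralTree

namespace ParentTree

variable {G : SimpleGraph V} (R : ParentTree G)

/-- The same tree, rooted at a child `s` of the root. -/
noncomputable def moveRoot {s : V} (hs : s ≠ R.root) (hs' : R.parent s = R.root) :
    ParentTree G where
  root := s
  parent v := if v = R.root ∨ v = s then s else R.parent v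
  depth v := if R.Desc v s then R.depth v - 1 else R.depth v + 1
  parent_root := by simp
  depth_root := by
    have := R.depth_parent s hs
    rw [hs', R.depth_root] at this
    rw [if_pos (R.desc_refl s)]
    omega
  depth_parent v hv := by
    have h1 := R.depth_parent s hs
    rw [hs', R.depth_root] at h1
    rcases eq_or_ne v R.root with rfl | h0
    · rw [if_pos (Or.inl rfl), if_pos (R.desc_refl s), R.desc_root_iff, if_neg hs, R.depth_root]
      omega
    · have h2 := R.depth_parent v h0
      have h3 : R.Desc v s ↔ R.Desc (R.parent v) s := by
        rw [R.desc_iff_eq_or v s]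
        simp [hv]
      have h4 : ¬ (v = R.root ∨ v = s) := by tauto
      simp only [h4, if_false, h3]
      split_ifs with h
      · have := depth_le_of_desc h
        omega
      · omega
  adj_iff u v := by
    have h : ∀ u v, ((u ≠ s ∧ (if u = R.root ∨ u = s then s else R.parent u) = v) ↔
        (u = R.root ∧ v = s) ∨ (u ≠ R.root ∧ u ≠ s ∧ R.parent u = v)) := by
      intro u v
      grind
    rw [h, h, R.adj_iff]
    grind

theorem desc_moveRoot_iff {s : V} (hs : s ≠ R.root) (hs' : R.parent s = R.root) (v : V) :
    (R.moveRoot hs hs').Desc v R.root ↔ ¬ R.Desc v s := by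
  induction v using R.parent_induction with
  | root => simp [R.desc_root_iff, hs, desc_refl]
  | step v hv ih =>
    rcases eq_or_ne v s with rfl | h
    · have := (not_congr ((R.moveRoot hs hs').desc_root_iff R.root)).2 hs.symm
      exact iff_of_false this (not_not.2 (R.desc_refl v))
    · rw [desc_iff_eq_or, R.desc_iff_eq_or v s, not_or, ← ih]
      have : (R.moveRoot hs hs').parent v = R.parent v := if_neg (by tauto)
      rw [this]
      tauto

theorem size_moveRoot_add [Fintype V] {s : V} (hs : s ≠ R.root) (hs' : R.parent s = R.root) :
    (R.moveRoot hs hs').size R.root + R.size s = Fintype.card V := by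
  simp only [size, desc_moveRoot_iff]
  rw [add_comm]
  exact Finset.card_filter_add_card_filter_not (s := Finset.univ) _

end ParentTree

namespace CentralTree

variable {G : SimpleGraph V} {r l : ℕ} (F : CentralTree G r l)

/-- Exchange the two ends of the longest path if there is a unique central vertex. -/
noncomputable def swap (h : l = r + 1) : CentralTree G r l where
  toParentTree := F.toParentTree
  branch := F.nearAt 1
  far := F.near
  near := F.far
  two_le := F.two_le
  radius_le := F.radius_le
  le_radius := F.le_radius
  branch_ne h0 := by
    have h1 := F.level_nearAt F.two_le
    rw [h0, F.level_root] at h1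
    omega
  parent_branch := by
    have h1 := F.level_nearAt F.two_le
    have h2 := F.level_parent (v := F.nearAt 1) (by omega)
    by_contra h0
    have := (F.eq_of_level_eq_zero (by omega) h0).2
    omega
  far_desc := F.near_desc_nearAt 1
  depth_far := by
    have := F.depth_near
    omega
  near_not_desc hd := by
    have h1 := F.level_nearAt F.two_le
    have h2 := (F.parent_iterate_level_sub hd (by omega)).2
    have h3 := F.level_far
    rw [h1, show F.level F.far - 1 = l - 1 - 1 by omega] at h2
    exact F.nearAt_ne_farAt le_rfl h2.symm
  depth_near := by
    have := F.depth_far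
    omega
  depth_le := F.depth_le
  depth_lt v _ := by
    have := F.depth_le v
    omega

/-- Exchange the two ends of the longest path if there are two central vertices. -/
noncomputable def moveRoot (h : l = r) : CentralTree G r l where
  toParentTree := F.toParentTree.moveRoot F.branch_ne F.parent_branch
  branch := F.root
  far := F.near
  near := F.far
  two_le := F.two_le
  radius_le := F.radius_le
  le_radius := F.le_radius
  branch_ne := F.branch_ne.symm
  parent_branch := if_pos (Or.inl rfl)
  far_desc := (F.desc_moveRoot_iff _ _ _).2 F.near_not_desc
  depth_far := by
    have := F.depth_near
    exact (if_neg F.near_not_desc).trans (by omega)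
  near_not_desc := by
    rw [ParentTree.desc_moveRoot_iff, not_not]
    exact F.far_desc
  depth_near := by
    have h1 := F.depth_far
    have h2 := F.one_le_depth F.far_desc
    have h3 : (F.toParentTree.moveRoot F.branch_ne F.parent_branch).depth F.far =
      F.depth F.far - 1 := if_pos F.far_desc
    omega
  depth_le v := by
    have h1 := F.depth_le v
    have h2 := F.depth_lt v
    by_cases hv : F.Desc v F.branch
    · exact (if_pos hv).trans_le (by omega)
    · have := h2 hv
      exact (if_neg hv).trans_le (by omega)
  depth_lt v hv := by
    rw [ParentTree.desc_moveRoot_iff, not_not] at hv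
    have h1 := F.depth_le v
    have h2 := F.one_le_depth hv
    exact (if_pos hv).trans_lt (by omega)

theorem exists_oriented [Fintype V] (F : CentralTree G r l) :
    ∃ F' : CentralTree G r l, F'.Oriented := by
  by_cases hF : F.Oriented
  · exact ⟨F, hF⟩
  rcases F.radius_le.eq_or_lt with h | h
  · have hF : Fintype.card V < 2 * F.size F.branch := by
      by_contra! h'
      exact hF ⟨fun _ => h', fun h0 => by omega⟩
    refine ⟨F.moveRoot h.symm, fun _ => ?_, fun h0 => by omega⟩
    have h1 := F.size_moveRoot_add F.branch_ne F.parent_branch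
    change 2 * (F.toParentTree.moveRoot F.branch_ne F.parent_branch).size F.root ≤ _
    omega
  · have hl : l = r + 1 := by
      have := F.le_radius
      omega
    have hF : F.size (F.nearAt 1) < F.size F.branch := by
      by_contra! h'
      exact hF ⟨fun h0 => by omega, fun _ => h'⟩
    refine ⟨F.swap hl, fun h0 => by omega, fun _ => ?_⟩
    change F.size (F.nearAt 1) ≤ F.size (F.farAt 1)
    rw [F.farAt_one hl]
    exact hF.le

end CentralTree

theorem ParentTree.Desc.eq_of_depth_eq {G : SimpleGraph V} {R : ParentTree G} {u v w : V}
    (hv : R.Desc u v) (hw : R.Desc u w) (h : R.depth v = R.depth w) : v = w := by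
  obtain ⟨i, rfl⟩ := hv
  obtain ⟨j, rfl⟩ := hw
  have key : ∀ i j, i ≤ j → R.Desc (R.parent^[i] u) (R.parent^[j] u) := fun i j hij =>
    ⟨j - i, by rw [← Function.iterate_add_apply]; congr 2; omega⟩
  rcases le_total i j with hij | hij
  · exact (key i j hij).eq_or_depth_lt.resolve_right (by omega)
  · exact ((key j i hij).eq_or_depth_lt.resolve_right (by omega)).symm

namespace CentralTree

variable {G : SimpleGraph V} {r l : ℕ} (F : CentralTree G r l)

/-- The position on the longest path (counted from `near`), or the depth of a vertex outside. -/
noncomputable def position (v : V) : ℕ ⊕ ℕ :=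
  if F.Desc v F.branch then Sum.inl (l - 1 + F.depth v)
  else if F.Desc F.near v then Sum.inl (l - 1 - F.depth v)
  else Sum.inr (F.depth v)

/-- The position of the parent of a vertex in terms of its own position. -/
def _root_.parentPosition (l : ℕ) : ℕ ⊕ ℕ → ℕ ⊕ ℕ
  | Sum.inl a => Sum.inl (if a < l - 1 then a + 1 else a - 1)
  | Sum.inr t => Sum.inl (l - t)

theorem position_of_desc {v : V} (h : F.Desc v F.branch) :
    F.position v = Sum.inl (l - 1 + F.depth v) := if_pos h

theorem position_of_near_desc {v : V} (h : F.Desc F.near v) :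
    F.position v = Sum.inl (l - 1 - F.depth v) := by
  rw [position, if_neg (F.not_desc_of_near_desc h), if_pos h]

theorem position_of_not_desc {v : V} (h : ¬ F.Desc v F.branch) (h' : ¬ F.Desc F.near v) :
    F.position v = Sum.inr (F.depth v) := by
  rw [position, if_neg h, if_neg h']

theorem position_eq_root_iff (v : V) : F.position v = Sum.inl (l - 1) ↔ v = F.root := by
  have hl := F.two_le
  rw [← F.depth_eq_zero_iff]
  by_cases h : F.Desc v F.branch
  · have := F.one_le_depth h
    rw [F.position_of_desc h, Sum.inl.injEq]
    omega
  · by_cases h' : F.Desc F.near v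
    · rw [F.position_of_near_desc h', Sum.inl.injEq]
      have := F.depth_lt v h
      omega
    · rw [F.position_of_not_desc h h']
      simp only [reduceCtorEq, false_iff]
      intro h0
      exact h' ((F.depth_eq_zero_iff v).1 h0 ▸ F.desc_root _)

theorem position_ne_inr {v : V} {t : ℕ} (ht : ¬ (1 ≤ t ∧ t < l)) : F.position v ≠ Sum.inr t := by
  by_cases h : F.Desc v F.branch
  · simp [F.position_of_desc h]
  · by_cases h' : F.Desc F.near v
    · simp [F.position_of_near_desc h']
    · rw [F.position_of_not_desc h h']
      rintro ⟨⟩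
      refine ht ⟨Nat.one_le_iff_ne_zero.2 fun h0 => ?_, F.depth_lt v h⟩
      exact h' ((F.depth_eq_zero_iff v).1 h0 ▸ F.desc_root _)

theorem lt_of_position_eq_inl {v : V} {a : ℕ} (h : F.position v = Sum.inl a) : a < r + l := by
  have hl := F.two_le
  by_cases h1 : F.Desc v F.branch
  · rw [F.position_of_desc h1, Sum.inl.injEq] at h
    have := F.depth_le v
    omega
  · by_cases h2 : F.Desc F.near v
    · rw [F.position_of_near_desc h2, Sum.inl.injEq] at h
      omega
    · simp [F.position_of_not_desc h1 h2] at h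

theorem exists_position_eq_inl {a : ℕ} (ha : a < r + l) : ∃ v, F.position v = Sum.inl a := by
  by_cases h : a < l
  · have h1 := F.depth_near
    have h2 := F.depth_iterate F.near (i := a) (by omega)
    refine ⟨F.parent^[a] F.near, ?_⟩
    rw [F.position_of_near_desc ⟨a, rfl⟩, Sum.inl.injEq]
    omega
  · have h1 := F.depth_far
    have h2 := F.depth_iterate F.far (i := r + l - 1 - a) (by omega)
    have h3 := F.depth_branch
    have h4 := F.two_le
    refine ⟨F.parent^[r + l - 1 - a] F.far, ?_⟩
    rw [F.position_of_desc (F.far_desc.iterate (by omega)), Sum.inl.injEq]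
    omega

variable [Fintype V] {F}

theorem Tight.eq_of_position_eq (hF : F.Tight) {u v : V} {a : ℕ} (hu : F.position u = Sum.inl a)
    (hv : F.position v = Sum.inl a) : u = v := by
  have hl := F.two_le
  have key : ∀ w, F.position w = Sum.inl a →
      (F.Desc w F.branch ∧ a = l - 1 + F.depth w ∧ 1 ≤ F.depth w) ∨
      (F.Desc F.near w ∧ a = l - 1 - F.depth w ∧ F.depth w < l) := by
    intro w hw
    by_cases h : F.Desc w F.branch
    · rw [F.position_of_desc h, Sum.inl.injEq] at hw
      exact Or.inl ⟨h, hw.symm, F.one_le_depth h⟩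
    · by_cases h' : F.Desc F.near w
      · rw [F.position_of_near_desc h', Sum.inl.injEq] at hw
        exact Or.inr ⟨h', hw.symm, F.depth_lt w h⟩
      · simp [F.position_of_not_desc h h'] at hw
  rcases key u hu with ⟨hu, hau, hdu⟩ | ⟨hu, hau, hdu⟩ <;>
    rcases key v hv with ⟨hv, hav, hdv⟩ | ⟨hv, hav, hdv⟩
  · exact (hF.far_desc hu).eq_of_depth_eq (hF.far_desc hv) (by omega)
  · omega
  · omega
  · exact hu.eq_of_depth_eq hv (by omega)

theorem Tight.position_parent (hF : F.Tight) {v : V} (hv : v ≠ F.root) :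
    F.position (F.parent v) = parentPosition l (F.position v) := by
  have hl := F.two_le
  have hd := F.depth_parent v hv
  by_cases h : F.Desc v F.branch
  · have h1 := F.one_le_depth h
    rw [F.position_of_desc h, parentPosition, if_neg (by omega)]
    rcases eq_or_ne v F.branch with rfl | hb
    · rw [F.parent_branch, (F.position_eq_root_iff _).2 rfl, Sum.inl.injEq, F.depth_branch]
      omega
    · rw [F.position_of_desc ((F.desc_parent_iff hb).2 h), Sum.inl.injEq]
      omega
  · have h1 := F.depth_lt v h
    by_cases h' : F.Desc F.near v
    · rw [F.position_of_near_desc h', F.position_of_near_desc h'.parent, parentPosition,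
        if_pos (by omega), Sum.inl.injEq]
      omega
    · have h2 : F.Desc F.near (F.parent v) := by
        by_contra h2
        have hb : v ≠ F.branch := fun hb => h (hb ▸ F.desc_refl _)
        have h3 := hF.2 _ (mt (F.desc_parent_iff hb).1 h) h2
        have h4 := F.lt_size_iterate (v := v) (i := 1) (by omega)
        rw [Function.iterate_one] at h4
        omega
      rw [F.position_of_not_desc h h', F.position_of_near_desc h2, parentPosition,
        Sum.inl.injEq]
      omega

theorem Tight.adj_iff (hF : F.Tight) (u v : V) : G.Adj u v ↔
    (F.position u ≠ Sum.inl (l - 1) ∧ F.position v = parentPosition l (F.position u)) ∨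
    (F.position v ≠ Sum.inl (l - 1) ∧ F.position u = parentPosition l (F.position v)) := by
  have key : ∀ u v, (u ≠ F.root ∧ F.parent u = v) ↔ (F.position u ≠ Sum.inl (l - 1) ∧
      F.position v = parentPosition l (F.position u)) := by
    intro u v
    rw [Ne, Ne, F.position_eq_root_iff]
    refine and_congr_right fun hu => ?_
    rw [← hF.position_parent hu]
    refine ⟨fun h => h ▸ rfl, fun h => ?_⟩
    obtain ⟨a, ha⟩ : ∃ a, F.position (F.parent u) = Sum.inl a := by
      rw [hF.position_parent hu]
      cases F.position u <;> exact ⟨_, rfl⟩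
    exact hF.eq_of_position_eq ha (h.trans ha)
  rw [F.toParentTree.adj_iff, key, key]

theorem Tight.card_position_inl (hF : F.Tight) (a : ℕ) :
    #{v | F.position v = Sum.inl a} = if a < r + l then 1 else 0 := by
  split_ifs with h
  · obtain ⟨v, hv⟩ := F.exists_position_eq_inl h
    refine Finset.card_eq_one.2 ⟨v, ?_⟩
    ext w
    simp only [Finset.mem_filter, Finset.mem_univ, true_and, Finset.mem_singleton]
    exact ⟨fun hw => hF.eq_of_position_eq hw hv, fun hw => hw ▸ hv⟩
  · rw [Finset.card_eq_zero, Finset.filter_eq_empty_iff]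
    exact fun v _ hv => h (F.lt_of_position_eq_inl hv)

theorem Tight.card_position_inr (hF : F.Tight) (t : ℕ) :
    #{v | F.position v = Sum.inr t} =
      if 1 ≤ t ∧ t < l then #{v | ecc G v = r + t} - 2 else 0 := by
  split_ifs with h
  · rw [F.filter_level_eq, ← card_erase_erase (L := {v | F.level v = t}) (a := F.nearAt t)
      (b := F.farAt t) (by simp [F.level_nearAt h.2]) (by simp [F.level_farAt h.2])
      (F.nearAt_ne_farAt h.1), Nat.add_sub_cancel]
    congr 1
    ext v
    simp only [Finset.mem_filter, Finset.mem_univ, true_and, Finset.mem_erase]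
    constructor
    · intro hv
      have h1 : ¬ F.Desc v F.branch := fun h1 => by simp [F.position_of_desc h1] at hv
      have h2 : ¬ F.Desc F.near v := fun h2 => by simp [F.position_of_near_desc h2] at hv
      rw [F.position_of_not_desc h1 h2, Sum.inr.injEq] at hv
      refine ⟨fun h3 => h1 (h3 ▸ F.farAt_desc h.1), fun h3 => h2 (h3 ▸ F.near_desc_nearAt t), ?_⟩
      rw [F.level_of_not_desc h1, hv]
    · rintro ⟨hfar, hnear, rfl⟩
      have h1 : ¬ F.Desc v F.branch := fun h1 =>
        hfar (F.eq_farAt (hF.far_desc h1) (by omega))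
      have h2 : ¬ F.Desc F.near v := fun h2 => hnear (F.eq_nearAt h2 (by omega))
      rw [F.position_of_not_desc h1 h2, F.level_of_not_desc h1]
  · rw [Finset.card_eq_zero, Finset.filter_eq_empty_iff]
    exact fun v _ => F.position_ne_inr h

theorem Tight.nonempty_iso {W : Type*} [Fintype W] {H : SimpleGraph W} {F' : CentralTree H r l}
    (hF : F.Tight) (hF' : F'.Tight)
    (hecc : ∀ e, #{v | ecc G v = e} = #{w | ecc H w = e}) : Nonempty (G ≃g H) := by
  have hcard : ∀ x, Fintype.card {v // F.position v = x} =
      Fintype.card {w // F'.position w = x} := by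
    intro x
    rw [Fintype.card_subtype, Fintype.card_subtype]
    cases x with
    | inl a => rw [hF.card_position_inl, hF'.card_position_inl]
    | inr t => rw [hF.card_position_inr, hF'.card_position_inr, hecc]
  let e := Equiv.ofFiberEquiv fun x => Fintype.equivOfCardEq (hcard x)
  have he : ∀ v, F'.position (e v) = F.position v := Equiv.ofFiberEquiv_map _
  exact ⟨⟨e, fun {u v} => by rw [hF.adj_iff, hF'.adj_iff, he, he]⟩⟩

end CentralTree

namespace stdCat

variable {r l : ℕ} {m : ℕ → ℕ}

/-- The parent of a vertex of the standard caterpillar rooted at `v_{l-1}`. -/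
def parent (hr : 1 ≤ r) : StdVert r l m → StdVert r l m
  | Sum.inl a =>
    if h : (a : ℕ) < l - 1 then Sum.inl ⟨a + 1, by omega⟩
    else if (a : ℕ) = l - 1 then Sum.inl a else Sum.inl ⟨a - 1, by omega⟩
  | Sum.inr ⟨i, _⟩ => Sum.inl ⟨l - 1 - i, by omega⟩

/-- The depth of a vertex of the standard caterpillar rooted at `v_{l-1}`. -/
def depth : StdVert r l m → ℕ
  | Sum.inl a => (l - 1 - a) + (a - (l - 1))
  | Sum.inr ⟨i, _⟩ => i + 1

theorem adj_inl_inl (a b : Fin (r + l)) : (stdCat r l m).Adj (Sum.inl a) (Sum.inl b) ↔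
    (a : ℕ) + 1 = b ∨ (b : ℕ) + 1 = a := by
  simp only [stdCat, SimpleGraph.fromRel_adj, stdRel, ne_eq, Sum.inl.injEq, Fin.ext_iff]
  omega

theorem adj_inr_inl (i : Fin (l - 1)) (j : Fin (m (i.1 + 2) - 2)) (a : Fin (r + l)) :
    (stdCat r l m).Adj (Sum.inr ⟨i, j⟩) (Sum.inl a) ↔ (a : ℕ) = l - 1 - i := by
  simp [stdCat, stdRel]

theorem not_adj_inr_inr (x y : (i : Fin (l - 1)) × Fin (m (i.1 + 2) - 2)) :
    ¬ (stdCat r l m).Adj (Sum.inr x) (Sum.inr y) := by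
  simp [stdCat, stdRel]

theorem parent_inl (hr : 1 ≤ r) (a b : Fin (r + l)) :
    parent (m := m) hr (Sum.inl a) = Sum.inl b ↔
      if (a : ℕ) < l - 1 then (b : ℕ) = a + 1 else (b : ℕ) = max ((a : ℕ) - 1) (l - 1) := by
  simp only [parent]
  split_ifs <;> simp only [Sum.inl.injEq, Fin.ext_iff] <;> omega

theorem parent_inr (hr : 1 ≤ r) (x : (i : Fin (l - 1)) × Fin (m (i.1 + 2) - 2))
    (b : Fin (r + l)) : parent hr (Sum.inr x) = Sum.inl b ↔ (b : ℕ) = l - 1 - x.1 := by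
  simp only [parent, Sum.inl.injEq, Fin.ext_iff]
  omega

theorem exists_parent_eq_inl (hr : 1 ≤ r) (v : StdVert r l m) :
    ∃ b, parent hr v = Sum.inl b := by
  rcases v with a | x
  · simp only [parent]
    split_ifs <;> exact ⟨_, rfl⟩
  · exact ⟨_, rfl⟩

theorem parent_ne_inr (hr : 1 ≤ r) (v : StdVert r l m)
    (x : (i : Fin (l - 1)) × Fin (m (i.1 + 2) - 2)) : parent hr v ≠ Sum.inr x := by
  obtain ⟨b, hb⟩ := exists_parent_eq_inl hr v
  simp [hb]

/-- The standard caterpillar rooted at `v_{l-1}`. -/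
def parentTree (hr : 1 ≤ r) (hl : 2 ≤ l) : ParentTree (stdCat r l m) where
  root := Sum.inl ⟨l - 1, by omega⟩
  parent := parent hr
  depth := depth
  parent_root := by simp [parent]
  depth_root := by simp [depth]
  depth_parent v hv := by
    obtain ⟨b, hb⟩ := exists_parent_eq_inl hr v
    rw [hb]
    rcases v with a | x
    · rw [parent_inl] at hb
      simp only [ne_eq, Sum.inl.injEq, Fin.ext_iff] at hv
      simp only [depth]
      split_ifs at hb <;> omega
    · rw [parent_inr] at hb
      simp only [depth]
      omega
  adj_iff u v := by
    rcases u with a | x <;> rcases v with b | y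
    · rw [adj_inl_inl, parent_inl, parent_inl]
      simp only [ne_eq, Sum.inl.injEq, Fin.ext_iff]
      split_ifs <;> omega
    · rw [SimpleGraph.adj_comm, adj_inr_inl, parent_inr]
      simp [parent_ne_inr]
    · rw [adj_inr_inl, parent_inr]
      simp [parent_ne_inr]
    · simp [not_adj_inr_inr, parent_ne_inr]

theorem desc_inl_iff (hr : 1 ≤ r) (hl : 2 ≤ l) (v : StdVert r l m) :
    (parentTree hr hl).Desc v (Sum.inl ⟨l, by omega⟩) ↔
      ∃ a : Fin (r + l), v = Sum.inl a ∧ l ≤ a := by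
  induction v using (parentTree (m := m) hr hl).parent_induction with
  | root =>
    rw [ParentTree.desc_root_iff]
    simp only [parentTree, Sum.inl.injEq, exists_eq_left']
    rw [Fin.ext_iff]
    simp only
    omega
  | step v hv ih =>
    obtain ⟨b, hb⟩ := exists_parent_eq_inl hr v
    rw [ParentTree.desc_iff_eq_or, ih]
    change _ ∨ (∃ a, parent hr v = Sum.inl a ∧ l ≤ a) ↔ _
    rw [hb]
    rcases v with a | x
    · rw [parent_inl] at hb
      change ¬ Sum.inl a = Sum.inl _ at hv
      rw [Sum.inl.injEq, Fin.ext_iff] at hv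
      simp only [Sum.inl.injEq, exists_eq_left']
      rw [Fin.ext_iff]
      simp only at hv ⊢
      split_ifs at hb <;> omega
    · rw [parent_inr] at hb
      simp only [reduceCtorEq, Sum.inl.injEq, exists_eq_left', false_and, exists_false, false_or,
        iff_false]
      omega

theorem inl_zero_desc (hr : 1 ≤ r) (hl : 2 ≤ l) {a : Fin (r + l)} (ha : (a : ℕ) < l) :
    (parentTree (m := m) hr hl).Desc (Sum.inl ⟨0, by omega⟩) (Sum.inl a) := by
  obtain ⟨a, ha'⟩ := a
  induction a with
  | zero => exact ParentTree.desc_refl _ _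
  | succ a ih =>
    have h := (ih (by omega) (by simp only at ha; simp only; omega)).parent
    have h' : (parentTree (m := m) hr hl).parent (Sum.inl ⟨a, by omega⟩) =
        Sum.inl ⟨a + 1, ha'⟩ := by
      refine (parent_inl hr _ _).2 ?_
      simp only at ha
      simp only [if_pos (show a < l - 1 by omega)]
    rwa [h'] at h

/-- The standard caterpillar as a central tree. -/
def centralTree (hr : 1 ≤ r) (hl : 2 ≤ l) (hrl : l = r ∨ l = r + 1) :
    CentralTree (stdCat r l m) r l where
  toParentTree := parentTree hr hl
  branch := Sum.inl ⟨l, by omega⟩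
  far := Sum.inl ⟨r + l - 1, by omega⟩
  near := Sum.inl ⟨0, by omega⟩
  two_le := hl
  radius_le := by omega
  le_radius := by omega
  branch_ne := by
    simp only [parentTree, ne_eq, Sum.inl.injEq, Fin.ext_iff]
    omega
  parent_branch := by
    refine (parent_inl hr _ _).2 ?_
    simp only
    rw [if_neg (by omega)]
    omega
  far_desc := by
    rw [desc_inl_iff]
    exact ⟨_, rfl, by simp only; omega⟩
  depth_far := by
    simp only [parentTree, depth]
    omega
  near_not_desc := by
    rw [desc_inl_iff]
    rintro ⟨a, ha, hla⟩
    rw [Sum.inl.injEq, Fin.ext_iff] at ha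
    simp only at ha
    omega
  depth_near := by
    simp only [parentTree, depth]
    omega
  depth_le v := by
    rcases v with a | x <;> simp only [parentTree, depth] <;> omega
  depth_lt v hv := by
    rw [desc_inl_iff] at hv
    rcases v with a | x
    · have : ¬ l ≤ a := fun h => hv ⟨a, rfl, h⟩
      simp only [parentTree, depth]
      omega
    · simp only [parentTree, depth]
      omega

theorem centralTree_tight (hr : 1 ≤ r) (hl : 2 ≤ l) (hrl : l = r ∨ l = r + 1) :
    (centralTree (m := m) hr hl hrl).Tight := by
  constructor
  · apply le_antisymm _ (centralTree hr hl hrl).le_size_branch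
    have hsub : ({u | (centralTree (m := m) hr hl hrl).Desc u (centralTree hr hl hrl).branch} :
        Finset (StdVert r l m)) ⊆
        Finset.univ.image fun i : Fin r => (Sum.inl ⟨l + i, by omega⟩ : StdVert r l m) := by
      intro u hu
      obtain ⟨a, rfl, ha⟩ := (desc_inl_iff hr hl u).1 (Finset.mem_filter.1 hu).2
      refine Finset.mem_image.2 ⟨⟨(a : ℕ) - l, by omega⟩, Finset.mem_univ _, ?_⟩
      rw [Sum.inl.injEq, Fin.ext_iff]
      simp only
      omega
    have := (Finset.card_le_card hsub).trans Finset.card_image_le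
    rwa [Finset.card_univ, Fintype.card_fin] at this
  · intro v hv hv'
    rcases v with a | x
    · by_cases ha : l ≤ (a : ℕ)
      · exact (hv ((desc_inl_iff hr hl _).2 ⟨a, rfl, ha⟩)).elim
      · exact (hv' (inl_zero_desc hr hl (by omega))).elim
    · refine Finset.card_eq_one.2 ⟨Sum.inr x, ?_⟩
      ext u
      simp only [Finset.mem_filter, Finset.mem_univ, true_and, Finset.mem_singleton]
      constructor
      · rintro ⟨i, hi⟩
        cases i with
        | zero => exact hi
        | succ i =>
          rw [Function.iterate_succ_apply'] at hi
          exact (parent_ne_inr hr _ _ hi).elim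
      · rintro rfl
        exact ParentTree.desc_refl _ _

end stdCat

theorem sameEccSeq.card_eq {W : Type*} [Fintype V] [Fintype W] {G : SimpleGraph V}
    {H : SimpleGraph W} (h : sameEccSeq G H) (e : ℕ) :
    #{v | ecc G v = e} = #{w | ecc H w = e} := by
  have := h e
  rwa [Nat.card_eq_fintype_card, Nat.card_eq_fintype_card, Fintype.card_subtype,
    Fintype.card_subtype] at this

theorem sameEccSeq.symm {W : Type*} [Fintype V] [Fintype W] {G : SimpleGraph V}
    {H : SimpleGraph W} (h : sameEccSeq G H) : sameEccSeq H G := fun e => (h e).symm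

theorem sameEccSeq.exists_ecc_eq {W : Type*} [Fintype V] [Fintype W] {G : SimpleGraph V}
    {H : SimpleGraph W} (h : sameEccSeq G H) (v : V) : ∃ w, ecc H w = ecc G v := by
  have h1 : v ∈ ({u | ecc G u = ecc G v} : Finset V) := by simp
  have h2 := Finset.card_pos.2 ⟨v, h1⟩
  rw [h.card_eq, Finset.card_pos] at h2
  obtain ⟨w, hw⟩ := h2
  exact ⟨w, (Finset.mem_filter.1 hw).2⟩

theorem sameEccSeq.card_le_eq {W : Type*} [Fintype V] [Fintype W] {G : SimpleGraph V}
    {H : SimpleGraph W} (h : sameEccSeq G H) (e : ℕ) :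
    #{v | e ≤ ecc G v} = #{w | e ≤ ecc H w} := by
  let s := Finset.univ.image (ecc G) ∪ Finset.univ.image (ecc H)
  rw [Finset.card_eq_sum_card_fiberwise (f := ecc G) (t := s) (by
    intro v _
    exact Finset.mem_union_left _ (Finset.mem_image_of_mem _ (Finset.mem_univ v))),
    Finset.card_eq_sum_card_fiberwise (f := ecc H) (t := s) (by
    intro v _
    exact Finset.mem_union_right _ (Finset.mem_image_of_mem _ (Finset.mem_univ v)))]
  refine Finset.sum_congr rfl fun i _ => ?_
  rw [Finset.filter_filter, Finset.filter_filter]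
  by_cases hi : e ≤ i
  · have h1 : ∀ j, (e ≤ j ∧ j = i) ↔ j = i := by omega
    simp only [h1, h.card_eq]
  · have h1 : ∀ j, (e ≤ j ∧ j = i) ↔ False := fun j => iff_false_intro (by omega)
    simp only [h1, Finset.filter_false, Finset.card_empty]

theorem sameEccSeq.card_vertices_eq {W : Type*} [Fintype V] [Fintype W] {G : SimpleGraph V}
    {H : SimpleGraph W} (h : sameEccSeq G H) : Fintype.card V = Fintype.card W := by
  simpa using h.card_le_eq 0

theorem sameEccSeq.totalBound_eq {W : Type*} [Fintype V] [Fintype W] {G : SimpleGraph V}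
    {H : SimpleGraph W} (h : sameEccSeq G H) (r l k : ℕ) :
    totalBound G r l k = totalBound H r l k := by
  simp only [totalBound, levelBound, h.card_eq, h.card_le_eq, h.card_vertices_eq]

theorem CentralTree.steinerWiener_add [Fintype V] {G : SimpleGraph V} {r l : ℕ}
    (F : CentralTree G r l) {k : ℕ} (hk : 1 ≤ k) :
    steinerWiener G k +
      ∑ v ∈ Finset.univ.erase F.root, splitCount (Fintype.card V) k (F.size v) =
      (Fintype.card V - 1) * (Fintype.card V).choose k :=
  ParentTree.steinerWiener_add F.toParentTree hk

theorem CentralTree.nonempty_of_sameEccSeq {W : Type*} [Fintype V] [Fintype W]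
    {G : SimpleGraph V} {H : SimpleGraph W} (hG : G.IsTree) (h : sameEccSeq G H) {r l : ℕ}
    (F : CentralTree H r l) : Nonempty (CentralTree G r l) := by
  have h1 := F.le_radius
  have h2 := F.radius_le
  obtain ⟨c, hc⟩ := h.symm.exists_ecc_eq F.root
  obtain ⟨x, hx⟩ := h.symm.exists_ecc_eq F.far
  rw [F.ecc_eq, F.level_root] at hc
  rw [F.ecc_eq] at hx
  refine hG.exists_centralTree F.two_le (by omega) hc (x := x) ?_ fun v => ?_
  · have := F.level_far
    omega
  · obtain ⟨w, hw⟩ := h.exists_ecc_eq v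
    rw [← hw, F.ecc_eq]
    have := F.level_lt w
    omega

/-- For a tree `T` with eccentric sequence `S = (r; m₂,…,m_l)` on `n` vertices,
diameter `d = r + l - 1`, and `k ∈ {2,…,n-1}`: `SW_k(T) ≥ SW_k(T(r; m₂,…,m_l))`;
and if `k ≤ n - ⌈d/2⌉` then equality implies `T ≅ T(r; m₂,…,m_l)`.
(Here `⌈d/2⌉ = (d+1)/2 = (r+l)/2` in natural division.) -/
theorem stmt17 [Fintype V] (r l : ℕ) (m : ℕ → ℕ)
    (hr : 1 ≤ r) (hl : 2 ≤ l) (hrl : l = r ∨ l = r + 1)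
    (hm : ∀ j : ℕ, 2 ≤ j → j ≤ l → 2 ≤ m j)
    (G : SimpleGraph V) (hG : G.IsTree) (hseq : sameEccSeq G (stdCat r l m))
    (k : ℕ) (hk1 : 2 ≤ k) (hk2 : k ≤ Fintype.card V - 1) :
    steinerWiener (stdCat r l m) k ≤ steinerWiener G k ∧
      (k ≤ Fintype.card V - (r + l) / 2 →
        steinerWiener G k = steinerWiener (stdCat r l m) k →
        Nonempty (G ≃g stdCat r l m)) := by
  let C := stdCat.centralTree (m := m) hr hl hrl
  have hC : C.Tight := stdCat.centralTree_tight hr hl hrl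
  obtain ⟨F₀⟩ := CentralTree.nonempty_of_sameEccSeq hG hseq C
  obtain ⟨F, hF⟩ := F₀.exists_oriented
  have h1 := F.steinerWiener_add (k := k) (by omega)
  have h2 := C.steinerWiener_add (k := k) (by omega)
  have h3 := F.sum_le_totalBound (k := k) (by omega)
  rw [hC.sum_eq_totalBound, ← hseq.totalBound_eq, ← hseq.card_vertices_eq] at h2
  refine ⟨by omega, fun hk heq => ?_⟩
  exact (F.tight_of_sum_eq hF hk1 (by omega) (by omega) (by omega)).nonempty_iso hC hseq.card_eq
end

section
/- Let g : ℕ → ℝ be nonnegative and strictly increasing, and let T be a tree with n vertices and diameter d (2 ≤ d ≤ n - 1). Then W(T; g) ≥ W(T_{d,n}; g), where T_{d,n} is the tree obtained from a path of order d+1 by attaching n - d - 1 pendent edges to a centre vertex of the path; equality holds if and only if T ≅ T_{d,n}. -/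
open SimpleGraph Finset

attribute [local instance] Classical.propDecidable

variable {V : Type*}

/-- Vertex type of `T_{d,n}`: the path `v_0,…,v_d` plus `n - d - 1` extra leaves. -/
abbrev TdnVert (n d : ℕ) : Type := Fin (d + 1) ⊕ Fin (n - d - 1)

/-- Base relation of `T_{d,n}`: consecutive path vertices are adjacent, and each of
the `n - d - 1` extra leaves is adjacent to the centre vertex `v_{⌈d/2⌉}`. -/
def tdnRel (n d : ℕ) : TdnVert n d → TdnVert n d → Prop
  | Sum.inl a, Sum.inl b => (a : ℕ) + 1 = (b : ℕ)
  | Sum.inr _, Sum.inl a => (a : ℕ) = (d + 1) / 2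
  | _, _ => False

/-- The tree `T_{d,n}` obtained from a path of order `d+1` by attaching `n - d - 1`
pendent edges to a centre vertex of the path. -/
def Tdn (n d : ℕ) : SimpleGraph (TdnVert n d) :=
  SimpleGraph.fromRel (tdnRel n d)

/-- The function `g` with its value at `1` raised to `g 2` and its value at `0` set to `0`. -/
noncomputable def flatten (g : ℕ → ℝ) (k : ℕ) : ℝ :=
  if k = 0 then 0 else if k = 1 then g 2 else g k

lemma flatten_monotone {g : ℕ → ℝ} (hg0 : ∀ k : ℕ, 0 ≤ g k) (hg : StrictMono g) :
    Monotone (flatten g) := by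
  refine monotone_nat_of_le_succ fun k => ?_
  rcases k with _ | _ | k
  · simpa [flatten] using hg0 2
  · simp [flatten]
  · simpa [flatten] using (hg (Nat.lt_succ_self (k + 2))).le

lemma flatten_lt {g : ℕ → ℝ} (hg : StrictMono g) {a b : ℕ} (ha : 1 ≤ a) (hab : a < b)
    (hb : 3 ≤ b) : flatten g a < flatten g b := by
  have hb' : flatten g b = g b := by
    rw [flatten, if_neg (by omega), if_neg (by omega)]
  rw [hb', flatten, if_neg (by omega)]
  split_ifs
  · exact hg (by omega)
  · exact hg hab

/-- Since a graph has as many unordered pairs at distance `1` as it has edges, flattening `g`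
changes the index by a multiple of the number of edges. -/
lemma two_mul_wiener [Fintype V] {G : SimpleGraph V} (hG : G.Connected) (g : ℕ → ℝ) :
    2 * wiener G g = ∑ a, ∑ b, flatten g (G.dist a b) + 2 * #G.edgeFinset * (g 1 - g 2) := by
  have h : ∑ p ∈ Finset.univ.offDiag, g (G.dist p.1 p.2) =
      ∑ p : V × V, (flatten g (G.dist p.1 p.2) + if G.Adj p.1 p.2 then g 1 - g 2 else 0) := by
    have : (Finset.univ : Finset V).offDiag = Finset.univ.filter fun p : V × V => p.1 ≠ p.2 := by
      ext; simp
    rw [this, Finset.sum_filter]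
    refine Finset.sum_congr rfl fun p _ => ?_
    by_cases hp : p.1 = p.2
    · simp [hp, flatten]
    · have h0 : G.dist p.1 p.2 ≠ 0 := by rwa [Ne, hG.dist_eq_zero_iff]
      simp only [← dist_eq_one_iff_adj, flatten, if_neg h0, if_pos hp, ne_eq]
      split_ifs with h1
      · rw [h1]; ring
      · ring
  have hE : ((2 * #G.edgeFinset : ℕ) : ℝ) = #(univ.filter fun p : V × V => G.Adj p.1 p.2) := by
    rw [two_mul_card_edgeFinset]
  rw [wiener, mul_div_cancel₀ _ two_ne_zero, h, Finset.sum_add_distrib, Fintype.sum_prod_type,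
    ← Finset.sum_filter, Finset.sum_const, nsmul_eq_mul, ← hE]
  push_cast
  ring

lemma SimpleGraph.IsTree.eq_of_adj_of_dist_eq {G : SimpleGraph V} (hG : G.IsTree) {u a b c : V}
    (hab : G.Adj a b) (hcb : G.Adj c b) (ha : G.dist u b = G.dist u a + 1)
    (hc : G.dist u b = G.dist u c + 1) : a = c := by
  obtain ⟨p, hp⟩ := hG.1.exists_walk_length_eq_dist u a
  obtain ⟨q, hq⟩ := hG.1.exists_walk_length_eq_dist u c
  have hp' : (p.concat hab).IsPath :=
    Walk.isPath_of_length_eq_dist _ (by rw [Walk.length_concat, hp, ha])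
  have hq' : (q.concat hcb).IsPath :=
    Walk.isPath_of_length_eq_dist _ (by rw [Walk.length_concat, hq, hc])
  have := congrArg Walk.penultimate ((hG.existsUnique_path u b).unique hp' hq')
  simpa using this

/-- A function with steps `±1` and no strict local maximum on `{0, …, d}` is V-shaped. -/
lemma exists_eq_add_abs_sub (f : ℕ → ℕ) (d : ℕ)
    (hstep : ∀ i < d, f (i + 1) = f i + 1 ∨ f i = f (i + 1) + 1)
    (hmax : ∀ i, i + 2 ≤ d → ¬ (f (i + 1) = f i + 1 ∧ f (i + 1) = f (i + 2) + 1)) :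
    ∃ j ≤ d, ∀ i ≤ d, f i = f j + (i - j + (j - i)) := by
  induction d with
  | zero => exact ⟨0, le_rfl, fun i hi => by simp [Nat.le_zero.mp hi]⟩
  | succ d ih =>
    obtain ⟨j, hj, h⟩ := ih (fun i hi => hstep i (by omega)) (fun i hi => hmax i (by omega))
    have hd := h d le_rfl
    rcases hstep d (Nat.lt_succ_self d) with hs | hs
    · refine ⟨j, by omega, fun i hi => ?_⟩
      rcases Nat.lt_or_ge d i with hi' | hi'
      · obtain rfl : i = d + 1 := by omega
        omega
      · exact h i hi'
    · obtain rfl : j = d := by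
        by_contra hne
        have h1 := h (d - 1) (by omega)
        have h2 := hmax (d - 1) (by omega)
        rw [show d - 1 + 1 = d by omega, show d - 1 + 2 = d + 1 by omega] at h2
        omega
      refine ⟨j + 1, le_rfl, fun i hi => ?_⟩
      rcases Nat.lt_or_ge j i with hi' | hi'
      · obtain rfl : i = j + 1 := by omega
        omega
      · have := h i hi'
        omega

lemma sum_range_abs_sub (F : ℕ → ℝ) (j k : ℕ) :
    ∑ i ∈ range (j + k + 1), F (i - j + (j - i)) =
      F 0 + (∑ x ∈ range j, F (x + 1) + ∑ x ∈ range k, F (x + 1)) := by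
  rw [add_assoc, Finset.sum_range_add, Finset.sum_range_succ', ← Finset.sum_range_reflect]
  have h1 : ∑ i ∈ range j, F (j - 1 - i - j + (j - (j - 1 - i))) =
      ∑ x ∈ range j, F (x + 1) :=
    Finset.sum_congr rfl fun i hi => by
      rw [Finset.mem_range] at hi
      congr 1
      omega
  have h2 : ∑ x ∈ range k, F (j + (x + 1) - j + (j - (j + (x + 1)))) =
      ∑ x ∈ range k, F (x + 1) :=
    Finset.sum_congr rfl fun i _ => by
      congr 1
      omega
  rw [h1, h2, show j + 0 - j + (j - (j + 0)) = 0 by omega]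
  ring

lemma sum_range_balanced_lt {F : ℕ → ℝ} (hF : StrictMono F) (t : ℕ) :
    ∀ j k : ℕ, k = j + 2 * (t + 1) ∨ k = j + 2 * (t + 1) + 1 →
      ∑ x ∈ range ((j + k) / 2), F x + ∑ x ∈ range ((j + k + 1) / 2), F x <
        ∑ x ∈ range j, F x + ∑ x ∈ range k, F x := by
  induction t with
  | zero =>
    rintro j k hk
    obtain ⟨l, rfl⟩ : ∃ l, k = l + 1 := ⟨k - 1, by omega⟩
    rw [show (j + (l + 1)) / 2 = j + 1 by omega, show (j + (l + 1) + 1) / 2 = l by omega,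
      Finset.sum_range_succ, Finset.sum_range_succ]
    have := hF (show j < l by omega)
    linarith
  | succ t ih =>
    rintro j k hk
    obtain ⟨l, rfl⟩ : ∃ l, k = l + 1 := ⟨k - 1, by omega⟩
    have h := ih (j + 1) l (by omega)
    rw [show j + 1 + l = j + (l + 1) by omega, Finset.sum_range_succ] at h
    rw [Finset.sum_range_succ _ l]
    have := hF (show j < l by omega)
    linarith

/-- The total weight from a leaf to the path it is attached to is smallest when it is attached at a
centre. -/
lemma sum_flatten_center {g : ℕ → ℝ} (hg : StrictMono g) {d j : ℕ} (hj : j ≤ d) :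
    ∑ i ∈ range (d + 1), flatten g (1 + (i - (d + 1) / 2 + ((d + 1) / 2 - i))) ≤
        ∑ i ∈ range (d + 1), flatten g (1 + (i - j + (j - i))) ∧
      (∑ i ∈ range (d + 1), flatten g (1 + (i - j + (j - i))) ≤
        ∑ i ∈ range (d + 1), flatten g (1 + (i - (d + 1) / 2 + ((d + 1) / 2 - i))) →
        j = (d + 1) / 2 ∨ j = d - (d + 1) / 2) := by
  have key : ∀ i ≤ d, ∑ x ∈ range (d + 1), flatten g (1 + (x - i + (i - x))) =
      flatten g 1 + (∑ x ∈ range i, g (x + 2) + ∑ x ∈ range (d - i), g (x + 2)) := fun i hi => by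
    have h := sum_range_abs_sub (fun k => flatten g (1 + k)) i (d - i)
    rw [show i + (d - i) = d by omega] at h
    rw [h]
    have e : ∀ x, flatten g (1 + (x + 1)) = g (x + 2) := fun x => by
      rw [show 1 + (x + 1) = x + 2 by omega]
      simp [flatten]
    simp only [e, add_zero]
  have hF : StrictMono fun x => g (x + 2) := fun a b hab => hg (by omega)
  by_cases hc : j = (d + 1) / 2 ∨ j = d - (d + 1) / 2
  · refine ⟨le_of_eq ?_, fun _ => hc⟩
    rw [key _ (by omega), key _ hj]
    rcases hc with rfl | rfl
    · rfl
    · rw [show d - (d - (d + 1) / 2) = (d + 1) / 2 by omega]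
      ring
  · suffices h : ∑ i ∈ range (d + 1), flatten g (1 + (i - (d + 1) / 2 + ((d + 1) / 2 - i))) <
        ∑ i ∈ range (d + 1), flatten g (1 + (i - j + (j - i))) from
      ⟨h.le, fun h' => absurd h h'.not_gt⟩
    rw [key _ (by omega), key _ hj, show d - (d + 1) / 2 = d / 2 by omega]
    rcases le_total j (d - j) with hjd | hjd
    · have := sum_range_balanced_lt hF ((d - j - j) / 2 - 1) j (d - j) (by omega)
      rw [show j + (d - j) = d by omega] at this
      linarith
    · have := sum_range_balanced_lt hF ((j - (d - j)) / 2 - 1) (d - j) j (by omega)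
      rw [show d - j + j = d by omega] at this
      linarith

/-- A vertex outside a geodesic of a tree sees it through a single vertex of the geodesic. -/
lemma SimpleGraph.IsTree.exists_dist_eq_add {G : SimpleGraph V} (hG : G.IsTree) {p : ℕ → V}
    {d : ℕ} (hp : ∀ i ≤ d, ∀ k ≤ d, G.dist (p i) (p k) = i - k + (k - i)) {u : V}
    (hu : ∀ i ≤ d, u ≠ p i) :
    ∃ j ≤ d, ∃ t ≥ 1, ∀ i ≤ d, G.dist u (p i) = t + (i - j + (j - i)) := by
  have hadj : ∀ i < d, G.Adj (p i) (p (i + 1)) := fun i hi => by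
    rw [← dist_eq_one_iff_adj, hp i hi.le _ hi]
    omega
  obtain ⟨j, hj, h⟩ := exists_eq_add_abs_sub (fun i => G.dist u (p i)) d
    (fun i hi => (hG.dist_eq_dist_add_one_of_adj u (hadj i hi)).symm) (fun i hi hmax => by
      have := hG.eq_of_adj_of_dist_eq (hadj i (by omega)) (hadj (i + 1) (by omega)).symm
        hmax.1 hmax.2
      have h2 := hp i (by omega) (i + 2) hi
      rw [this, dist_self] at h2
      omega)
  exact ⟨j, hj, _, hG.1.pos_dist_of_ne (hu j hj), h⟩

lemma SimpleGraph.Connected.exists_geodesic {G : SimpleGraph V} (hG : G.Connected) (x y : V) :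
    ∃ p : ℕ → V, ∀ i ≤ G.dist x y, ∀ k ≤ G.dist x y, G.dist (p i) (p k) = i - k + (k - i) := by
  obtain ⟨w, hw⟩ := hG.exists_walk_length_eq_dist x y
  have hle : ∀ i m, i + m ≤ G.dist x y → G.dist (w.getVert i) (w.getVert (i + m)) ≤ m := by
    intro i m
    induction m with
    | zero => simp
    | succ m ih =>
      intro h
      have h1 := ih (by omega)
      have h2 := dist_eq_one_iff_adj.2 (w.adj_getVert_succ (i := i + m) (by omega))
      have h3 := hG.dist_triangle (u := w.getVert i) (v := w.getVert (i + m))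
        (w := w.getVert (i + m + 1))
      rw [← add_assoc]
      omega
  have heq : ∀ i m, i + m ≤ G.dist x y → G.dist (w.getVert i) (w.getVert (i + m)) = m := by
    intro i m h
    have h1 := hle 0 i (by omega)
    have h2 := hle i m h
    have h3 := hle (i + m) (G.dist x y - (i + m)) (by omega)
    rw [show i + m + (G.dist x y - (i + m)) = w.length by omega, w.getVert_length] at h3
    rw [zero_add, w.getVert_zero] at h1
    have h4 := hG.dist_triangle (u := x) (v := w.getVert i) (w := y)
    have h5 := hG.dist_triangle (u := w.getVert i) (v := w.getVert (i + m)) (w := y)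
    omega
  refine ⟨w.getVert, fun i hi k hk => ?_⟩
  rcases le_total i k with h | h
  · obtain ⟨m, rfl⟩ := Nat.exists_eq_add_of_le h
    rw [heq i m hk]
    omega
  · obtain ⟨m, rfl⟩ := Nat.exists_eq_add_of_le h
    rw [SimpleGraph.dist_comm, heq k m hi]
    omega

lemma exists_dist_eq_graphDiam [Fintype V] [Nonempty V] (G : SimpleGraph V) :
    ∃ x y, G.dist x y = graphDiam G := by
  obtain ⟨x, -, hx⟩ := Finset.exists_mem_eq_sup univ univ_nonempty fun v => ecc G v
  obtain ⟨y, -, hy⟩ := Finset.exists_mem_eq_sup univ univ_nonempty fun u => G.dist x u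
  exact ⟨x, y, by rw [graphDiam, hx, ecc, hy]⟩

/-- The vertices of a connected graph on `n` vertices with diameter `d` can be labelled by the
vertices of `T_{d,n}` in such a way that the path is a geodesic. -/
lemma exists_equiv_tdnVert [Fintype V] {G : SimpleGraph V} (hG : G.Connected) {n d : ℕ}
    (hcard : Fintype.card V = n) (hdiam : graphDiam G = d) :
    ∃ (e : TdnVert n d ≃ V) (p : ℕ → V), (∀ i : Fin (d + 1), e (Sum.inl i) = p i) ∧
      ∀ i ≤ d, ∀ k ≤ d, G.dist (p i) (p k) = i - k + (k - i) := by
  have := hG.nonempty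
  obtain ⟨x, y, hxy⟩ := exists_dist_eq_graphDiam G
  obtain ⟨p, hp⟩ := hG.exists_geodesic x y
  rw [hxy, hdiam] at hp
  have hinj : Function.Injective fun i : Fin (d + 1) => p i := fun i k hik => by
    have h := hp i (by omega) k (by omega)
    simp only at hik
    rw [hik, dist_self] at h
    omega
  have hc : Fintype.card (Fin (n - d - 1)) =
      Fintype.card ↑(Set.range fun i : Fin (d + 1) => p i)ᶜ := by
    rw [Fintype.card_compl_set, Set.card_range_of_injective hinj, hcard]
    simp only [Fintype.card_fin]
    omega
  exact ⟨(Equiv.sumCongr (Equiv.ofInjective _ hinj) (Fintype.equivOfCardEq hc)).trans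
    (Equiv.Set.sumCompl _), p, fun i => by simp, hp⟩

lemma tdn_dist_path_add_le (n d : ℕ) (i m : ℕ) (h : i + m < d + 1) :
    (Tdn n d).Reachable (Sum.inl ⟨i, by omega⟩) (Sum.inl ⟨i + m, h⟩) ∧
      (Tdn n d).dist (Sum.inl ⟨i, by omega⟩) (Sum.inl ⟨i + m, h⟩) ≤ m := by
  induction m with
  | zero => exact ⟨.rfl, by simp⟩
  | succ m ih =>
    obtain ⟨h1, h2⟩ := ih (by omega)
    have ha : (Tdn n d).Adj (Sum.inl ⟨i + m, by omega⟩) (Sum.inl ⟨i + (m + 1), h⟩) := by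
      simp only [Tdn, fromRel_adj, tdnRel, ne_eq, Sum.inl.injEq, Fin.mk.injEq]
      omega
    have h3 := dist_eq_one_iff_adj.2 ha
    have h4 := h1.dist_triangle_left (Sum.inl ⟨i + (m + 1), h⟩)
    exact ⟨h1.trans ha.reachable, by omega⟩

lemma tdn_adj_leaf (n d : ℕ) (r : Fin (n - d - 1)) :
    (Tdn n d).Adj (Sum.inr r) (Sum.inl ⟨(d + 1) / 2, by omega⟩) := by
  simp [Tdn, fromRel_adj, tdnRel]

lemma tdn_connected (n d : ℕ) : (Tdn n d).Connected := by
  have h0 : ∀ i : Fin (d + 1), (Tdn n d).Reachable (Sum.inl 0) (Sum.inl i) := fun i => by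
    have := (tdn_dist_path_add_le n d 0 i (by omega)).1
    simpa using this
  have h : ∀ x, (Tdn n d).Reachable (Sum.inl 0) x := by
    rintro (i | r)
    · exact h0 i
    · exact (h0 _).trans (tdn_adj_leaf n d r).reachable.symm
  exact ⟨fun x y => (h x).symm.trans (h y)⟩

lemma tdn_dist_path_le (n d : ℕ) (i k : Fin (d + 1)) :
    (Tdn n d).dist (Sum.inl i) (Sum.inl k) ≤ (i : ℕ) - k + (k - i) := by
  rcases i with ⟨i, hi⟩
  rcases k with ⟨k, hk⟩
  rcases le_total i k with h | h
  · obtain ⟨m, rfl⟩ := Nat.exists_eq_add_of_le h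
    have := (tdn_dist_path_add_le n d i m hk).2
    simp only
    omega
  · obtain ⟨m, rfl⟩ := Nat.exists_eq_add_of_le h
    have := (tdn_dist_path_add_le n d k m hi).2
    rw [SimpleGraph.dist_comm]
    simp only
    omega

lemma tdn_dist_leaf_path_le (n d : ℕ) (r : Fin (n - d - 1)) (i : Fin (d + 1)) :
    (Tdn n d).dist (Sum.inr r) (Sum.inl i) ≤
      1 + ((i : ℕ) - (d + 1) / 2 + ((d + 1) / 2 - i)) := by
  have h1 := dist_eq_one_iff_adj.2 (tdn_adj_leaf n d r)
  have h2 := tdn_dist_path_le n d ⟨(d + 1) / 2, by omega⟩ i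
  have h3 := (tdn_connected n d).dist_triangle (u := Sum.inr r)
    (v := Sum.inl ⟨(d + 1) / 2, by omega⟩) (w := Sum.inl i)
  simp only at h2
  omega

lemma tdn_dist_leaf_le (n d : ℕ) (r s : Fin (n - d - 1)) :
    (Tdn n d).dist (Sum.inr r) (Sum.inr s) ≤ 2 := by
  have h1 := dist_eq_one_iff_adj.2 (tdn_adj_leaf n d r)
  have h2 := dist_eq_one_iff_adj.2 (tdn_adj_leaf n d s).symm
  have h3 := (tdn_connected n d).dist_triangle (u := Sum.inr r)
    (v := Sum.inl ⟨(d + 1) / 2, by omega⟩) (w := Sum.inr s)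
  omega

/-- A labelling of the vertices with the distances of `T_{d,n}` is an isomorphism. -/
lemma nonempty_iso_tdn_of_dist {G : SimpleGraph V} {n d : ℕ} (e : TdnVert n d ≃ V)
    (hpath : ∀ i k : Fin (d + 1), G.dist (e (Sum.inl i)) (e (Sum.inl k)) = (i : ℕ) - k + (k - i))
    (hleaf : ∀ r, ∀ i : Fin (d + 1), G.dist (e (Sum.inr r)) (e (Sum.inl i)) =
      1 + ((i : ℕ) - (d + 1) / 2 + ((d + 1) / 2 - i)))
    (hnadj : ∀ r s, ¬ G.Adj (e (Sum.inr r)) (e (Sum.inr s))) :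
    Nonempty (G ≃g Tdn n d) := by
  refine ⟨RelIso.symm ⟨e, ?_⟩⟩
  rintro (i | r) (k | s)
  · rw [← dist_eq_one_iff_adj, hpath]
    simp only [Tdn, fromRel_adj, tdnRel, ne_eq, Sum.inl.injEq, Fin.ext_iff]
    omega
  · rw [G.adj_comm, ← dist_eq_one_iff_adj, hleaf]
    simp only [Tdn, fromRel_adj, tdnRel, ne_eq, reduceCtorEq, not_false_eq_true, true_and,
      false_or]
    omega
  · rw [← dist_eq_one_iff_adj, hleaf]
    simp only [Tdn, fromRel_adj, tdnRel, ne_eq, reduceCtorEq, not_false_eq_true, true_and,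
      or_false]
    omega
  · simp [Tdn, fromRel_adj, tdnRel, hnadj]

lemma nonempty_iso_tdn {G : SimpleGraph V} (hG : G.IsTree) {n d j : ℕ} (hj : j ≤ d)
    (e : TdnVert n d ≃ V)
    (hpath : ∀ i k : Fin (d + 1), G.dist (e (Sum.inl i)) (e (Sum.inl k)) = (i : ℕ) - k + (k - i))
    (hcenter : j = (d + 1) / 2 ∨ j = d - (d + 1) / 2)
    (hleaf : ∀ r, ∀ i : Fin (d + 1), G.dist (e (Sum.inr r)) (e (Sum.inl i)) =
      1 + ((i : ℕ) - j + (j - i))) :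
    Nonempty (G ≃g Tdn n d) := by
  have hnadj : ∀ r s, ¬ G.Adj (e (Sum.inr r)) (e (Sum.inr s)) := fun r s hrs => by
    refine hG.dist_ne_of_adj (e (Sum.inl ⟨j, by omega⟩)) hrs ?_
    rw [SimpleGraph.dist_comm, hleaf, SimpleGraph.dist_comm, hleaf]
  rcases hcenter with rfl | rfl
  · exact nonempty_iso_tdn_of_dist e hpath hleaf hnadj
  · refine nonempty_iso_tdn_of_dist ((Equiv.sumCongr Fin.revPerm (Equiv.refl _)).trans e)
      (fun i k => ?_) (fun r i => ?_) (fun r s => ?_)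
    · simp only [Equiv.trans_apply, Equiv.sumCongr_apply, Sum.map_inl, Fin.revPerm_apply, hpath,
        Fin.val_rev]
      omega
    · simp only [Equiv.trans_apply, Equiv.sumCongr_apply, Sum.map_inl, Sum.map_inr,
        Fin.revPerm_apply, Equiv.refl_apply, hleaf, Fin.val_rev]
      omega
    · simpa using hnadj r s

lemma wiener_eq_of_iso {W : Type*} [Fintype V] [Fintype W] {G : SimpleGraph V}
    {H : SimpleGraph W} (hG : G.Connected) (hH : H.Connected) (f : G ≃g H) (g : ℕ → ℝ) :
    wiener G g = wiener H g := by
  have hd : ∀ a b, H.dist (f a) (f b) = G.dist a b := fun a b => by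
    refine le_antisymm ?_ ?_
    · obtain ⟨w, hw⟩ := hG.exists_walk_length_eq_dist a b
      rw [← hw, ← Walk.length_map f.toHom w]
      exact dist_le _
    · obtain ⟨w, hw⟩ := hH.exists_walk_length_eq_dist (f a) (f b)
      rw [← hw, ← Walk.length_map f.symm.toHom w]
      simpa using dist_le (Walk.map f.symm.toHom w)
  have hE : #G.edgeFinset = #H.edgeFinset := f.card_edgeFinset_eq
  have h : 2 * wiener G g = 2 * wiener H g := by
    rw [two_mul_wiener hG, two_mul_wiener hH, hE, ← f.toEquiv.sum_comp]
    congr 1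
    refine Finset.sum_congr rfl fun a _ => ?_
    rw [← f.toEquiv.sum_comp]
    exact Finset.sum_congr rfl fun b _ => congrArg _ (hd a b).symm
  linarith

lemma sum_tdnVert {n d : ℕ} (F : TdnVert n d → TdnVert n d → ℝ) (hF : ∀ x y, F x y = F y x) :
    ∑ x, ∑ y, F x y = ∑ i, ∑ k, F (Sum.inl i) (Sum.inl k) +
      2 * ∑ r, ∑ i, F (Sum.inr r) (Sum.inl i) + ∑ r, ∑ s, F (Sum.inr r) (Sum.inr s) := by
  simp only [Fintype.sum_sum_type, Finset.sum_add_distrib]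
  rw [Finset.sum_comm (f := fun i r => F (Sum.inl i) (Sum.inr r))]
  simp only [hF (Sum.inl _) (Sum.inr _)]
  ring

lemma tdn_leaf_le_flatten {g : ℕ → ℝ} (hg0 : ∀ k : ℕ, 0 ≤ g k) (hg : StrictMono g)
    {G : SimpleGraph V} (hG : G.Connected) {n d : ℕ} (e : TdnVert n d ≃ V)
    (r s : Fin (n - d - 1)) :
    flatten g ((Tdn n d).dist (Sum.inr r) (Sum.inr s)) ≤
      flatten g (G.dist (e (Sum.inr r)) (e (Sum.inr s))) := by
  have hmono := flatten_monotone hg0 hg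
  by_cases h : r = s
  · simp [h]
  · have hpos : 1 ≤ G.dist (e (Sum.inr r)) (e (Sum.inr s)) :=
      hG.pos_dist_of_ne (by simpa using h)
    calc _ ≤ flatten g 2 := hmono (tdn_dist_leaf_le n d r s)
      _ = flatten g 1 := by simp [flatten]
      _ ≤ _ := hmono hpos

/-- The contribution of a vertex at distance `t` from a geodesic, compared with the contribution
of a leaf at a centre. -/
lemma sum_flatten_add {g : ℕ → ℝ} (hg0 : ∀ k : ℕ, 0 ≤ g k) (hg : StrictMono g) {d j t : ℕ}
    (hd : 2 ≤ d) (hj : j ≤ d) (ht : 1 ≤ t) :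
    ∑ i ∈ range (d + 1), flatten g (1 + (i - (d + 1) / 2 + ((d + 1) / 2 - i))) ≤
        ∑ i ∈ range (d + 1), flatten g (t + (i - j + (j - i))) ∧
      (∑ i ∈ range (d + 1), flatten g (t + (i - j + (j - i))) ≤
        ∑ i ∈ range (d + 1), flatten g (1 + (i - (d + 1) / 2 + ((d + 1) / 2 - i))) →
        t = 1 ∧ (j = (d + 1) / 2 ∨ j = d - (d + 1) / 2)) := by
  have hmono := flatten_monotone hg0 hg
  obtain ⟨h1, h2⟩ := sum_flatten_center hg hj
  rcases ht.eq_or_lt with rfl | ht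
  · exact ⟨h1, fun h => ⟨rfl, h2 h⟩⟩
  · have hlt : ∑ i ∈ range (d + 1), flatten g (1 + (i - j + (j - i))) <
        ∑ i ∈ range (d + 1), flatten g (t + (i - j + (j - i))) := by
      obtain ⟨i, hi, hij⟩ : ∃ i < d + 1, i ≠ j := by
        by_cases h : j = 0
        · exact ⟨1, by omega, by omega⟩
        · exact ⟨0, by omega, by omega⟩
      exact Finset.sum_lt_sum (fun i _ => hmono (by omega))
        ⟨i, Finset.mem_range.2 hi, flatten_lt hg (by omega) (by omega) (by omega)⟩
    exact ⟨(h1.trans_lt hlt).le, fun h => absurd (h1.trans_lt hlt) h.not_gt⟩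

lemma le_two_of_flatten_le {g : ℕ → ℝ} (hg : StrictMono g) {k : ℕ}
    (h : flatten g k ≤ flatten g 2) : k ≤ 2 := by
  by_contra hk
  exact absurd (flatten_lt hg (by omega) (by omega : 2 < k) (by omega)) h.not_gt

/-- Two vertices at distance at most `2` in a tree that are both adjacent to nearly central
vertices of a geodesic are adjacent to the same vertex of the geodesic. -/
lemma SimpleGraph.IsTree.foot_eq {G : SimpleGraph V} (hG : G.IsTree) {p : ℕ → V} {d : ℕ}
    (hp : ∀ i ≤ d, ∀ k ≤ d, G.dist (p i) (p k) = i - k + (k - i)) {u w : V} {j k : ℕ}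
    (hj : j ≤ d) (hk : k ≤ d) (hjk : j - k + (k - j) ≤ 1)
    (hu : ∀ i ≤ d, G.dist u (p i) = 1 + (i - j + (j - i)))
    (hw : ∀ i ≤ d, G.dist w (p i) = 1 + (i - k + (k - i)))
    (huw : u ≠ w) (h2 : G.dist u w ≤ 2) : j = k := by
  by_contra hne
  have hwk : G.Adj w (p k) := by rw [← dist_eq_one_iff_adj, hw k hk]; omega
  have hjk' : G.Adj (p j) (p k) := by rw [← dist_eq_one_iff_adj, hp j hj k hk]; omega
  have h1 := hu k hk
  have h3 := hu j hj
  have h4 := hG.dist_ne_of_adj u hwk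
  have h5 := hG.1.pos_dist_of_ne huw
  have := hG.eq_of_adj_of_dist_eq (u := u) hwk hjk' (by omega) (by omega)
  have h6 := hw j hj
  rw [this, dist_self] at h6
  omega

/-- For nonnegative strictly increasing `g` and any tree `T` with `n` vertices and
diameter `d` (`2 ≤ d ≤ n-1`): `W(T;g) ≥ W(T_{d,n};g)`, with equality iff `T ≅ T_{d,n}`. -/
theorem stmt18 [Fintype V] (g : ℕ → ℝ) (hg0 : ∀ k : ℕ, 0 ≤ g k) (hg : StrictMono g)
    (n d : ℕ) (hd2 : 2 ≤ d) (hdn : d ≤ n - 1)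
    (G : SimpleGraph V) (hG : G.IsTree)
    (hcard : Fintype.card V = n) (hdiam : graphDiam G = d) :
    wiener (Tdn n d) g ≤ wiener G g ∧
      (wiener G g = wiener (Tdn n d) g ↔ Nonempty (G ≃g Tdn n d)) := by
  have hV : Nonempty V := hG.1.nonempty
  have hn : 0 < Fintype.card V := Fintype.card_pos
  have hmono := flatten_monotone hg0 hg
  obtain ⟨e, p, hep, hp⟩ := exists_equiv_tdnVert hG.1 hcard hdiam
  have hout : ∀ r, ∀ i ≤ d, e (Sum.inr r) ≠ p i := fun r i hi h => by
    have := hep ⟨i, by omega⟩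
    rw [← h] at this
    exact Sum.inl_ne_inr (e.injective this)
  choose j hj t ht hjt using fun r => hG.exists_dist_eq_add hp (hout r)
  set C := ∑ i ∈ range (d + 1), flatten g (1 + (i - (d + 1) / 2 + ((d + 1) / 2 - i))) with hC
  have hGleaf : ∀ r, ∑ i : Fin (d + 1), flatten g (G.dist (e (Sum.inr r)) (e (Sum.inl i))) =
      ∑ i ∈ range (d + 1), flatten g (t r + (i - j r + (j r - i))) := fun r => by
    rw [← Fin.sum_univ_eq_sum_range (fun i => flatten g (t r + (i - j r + (j r - i))))]
    exact Finset.sum_congr rfl fun i _ => by rw [hep, hjt r i (by omega)]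
  have hTleaf : ∀ r, ∑ i : Fin (d + 1), flatten g ((Tdn n d).dist (Sum.inr r) (Sum.inl i)) ≤ C :=
    fun r => by
      rw [hC, ← Fin.sum_univ_eq_sum_range
        (fun i => flatten g (1 + (i - (d + 1) / 2 + ((d + 1) / 2 - i))))]
      exact Finset.sum_le_sum fun i _ => hmono (tdn_dist_leaf_path_le n d r i)
  have hCle : ∀ r, C ≤ ∑ i : Fin (d + 1), flatten g (G.dist (e (Sum.inr r)) (e (Sum.inl i))) :=
    fun r => (hGleaf r).symm ▸ (sum_flatten_add hg0 hg hd2 (hj r) (ht r)).1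
  have hpath : ∀ i k : Fin (d + 1),
      G.dist (e (Sum.inl i)) (e (Sum.inl k)) = (i : ℕ) - k + (k - i) := fun i k => by
    rw [hep, hep, hp i (by omega) k (by omega)]
  have hleafleaf := tdn_leaf_le_flatten hg0 hg hG.1 e
  have hsumG : 2 * wiener G g = ∑ x, ∑ y, flatten g (G.dist (e x) (e y)) +
      2 * #G.edgeFinset * (g 1 - g 2) := by
    rw [two_mul_wiener hG.1, ← e.sum_comp]
    congr 1
    exact Finset.sum_congr rfl fun x _ => (e.sum_comp _).symm
  rw [sum_tdnVert _ fun x y => by rw [SimpleGraph.dist_comm]] at hsumG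
  have hsumT := two_mul_wiener (tdn_connected n d) g
  rw [sum_tdnVert _ fun x y => by rw [SimpleGraph.dist_comm]] at hsumT
  have hedges : (#G.edgeFinset : ℝ) * (g 1 - g 2) ≥ #(Tdn n d).edgeFinset * (g 1 - g 2) := by
    have h1 := hG.card_edgeFinset
    have h2 := (tdn_connected n d).card_vert_le_card_edgeSet_add_one
    rw [Nat.card_eq_fintype_card, Nat.card_eq_fintype_card, ← edgeFinset_card,
      Fintype.card_sum, Fintype.card_fin, Fintype.card_fin] at h2
    have h3 : (#G.edgeFinset : ℝ) ≤ #(Tdn n d).edgeFinset := by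
      exact_mod_cast (by omega : #G.edgeFinset ≤ #(Tdn n d).edgeFinset)
    have := hg (show 1 < 2 by omega)
    exact mul_le_mul_of_nonpos_right h3 (by linarith)
  have hPP : ∑ i : Fin (d + 1), ∑ k : Fin (d + 1),
        flatten g ((Tdn n d).dist (Sum.inl i) (Sum.inl k)) ≤
      ∑ i : Fin (d + 1), ∑ k : Fin (d + 1), flatten g (G.dist (e (Sum.inl i)) (e (Sum.inl k))) :=
    Finset.sum_le_sum fun i _ => Finset.sum_le_sum fun k _ =>
      hmono (hpath i k ▸ tdn_dist_path_le n d i k)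
  have hLP : ∑ r, ∑ i : Fin (d + 1), flatten g ((Tdn n d).dist (Sum.inr r) (Sum.inl i)) ≤
      ∑ r, ∑ i : Fin (d + 1), flatten g (G.dist (e (Sum.inr r)) (e (Sum.inl i))) :=
    Finset.sum_le_sum fun r _ => (hTleaf r).trans (hCle r)
  have hLL : ∑ r, ∑ s, flatten g ((Tdn n d).dist (Sum.inr r) (Sum.inr s)) ≤
      ∑ r, ∑ s, flatten g (G.dist (e (Sum.inr r)) (e (Sum.inr s))) :=
    Finset.sum_le_sum fun r _ => Finset.sum_le_sum fun s _ => hleafleaf r s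
  refine ⟨by linarith, fun heq => ?_, fun ⟨f⟩ => wiener_eq_of_iso hG.1 (tdn_connected n d) f g⟩
  have hLPr := (Finset.sum_eq_sum_iff_of_le fun r _ => (hTleaf r).trans (hCle r)).1
    (le_antisymm hLP (by linarith))
  have hLLr := (Finset.sum_eq_sum_iff_of_le fun r _ =>
    Finset.sum_le_sum fun s _ => hleafleaf r s).1 (le_antisymm hLL (by linarith))
  have hcenter : ∀ r, t r = 1 ∧ (j r = (d + 1) / 2 ∨ j r = d - (d + 1) / 2) := fun r =>
    (sum_flatten_add hg0 hg hd2 (hj r) (ht r)).2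
      (hGleaf r ▸ (hLPr r (Finset.mem_univ r)).symm.trans_le (hTleaf r))
  have hfoot : ∀ r i, i ≤ d → G.dist (e (Sum.inr r)) (p i) = 1 + (i - j r + (j r - i)) :=
    fun r i hi => by rw [hjt r i hi, (hcenter r).1]
  have hsame : ∀ r s, j r = j s := fun r s => by
    by_cases hrs : r = s
    · rw [hrs]
    refine hG.foot_eq hp (hj r) (hj s) ?_ (hfoot r) (hfoot s) (by simpa using hrs) ?_
    · have hr := (hcenter r).2
      have hs := (hcenter s).2
      omega
    · have h := (Finset.sum_eq_sum_iff_of_le fun s _ => hleafleaf r s).1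
        (hLLr r (Finset.mem_univ r)) s (Finset.mem_univ s)
      exact le_two_of_flatten_le hg (h ▸ hmono (tdn_dist_leaf_le n d r s))
  obtain ⟨c, hc, hcc, hcj⟩ : ∃ c ≤ d, (c = (d + 1) / 2 ∨ c = d - (d + 1) / 2) ∧
      ∀ r, j r = c := by
    rcases isEmpty_or_nonempty (Fin (n - d - 1)) with _ | ⟨⟨r⟩⟩
    · exact ⟨(d + 1) / 2, by omega, .inl rfl, isEmptyElim⟩
    · exact ⟨j r, hj r, (hcenter r).2, fun s => hsame s r⟩
  exact nonempty_iso_tdn hG hc e hpath hcc fun r i => by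
    rw [hep, hfoot r i (by omega), hcj r]
end
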